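/- arXiv:2504.02669 — 7 statements merged into one kernel-verified Lean document; each statement's English description precedes it below -/
import Mathlib

section
/- Let k be a nonzero integer and let G_k : [-1,1]² → ℝ be defined by G_k(y,y') = -sinh(k(1-y'))·sinh(k(1+y))/(k·sinh(2k)) if y ≤ y' and G_k(y,y') = -sinh(k(1-y))·sinh(k(1+y'))/(k·sinh(2k)) if y ≥ y'. Then for every continuous function f : [-1,1] → ℂ, the function ψ(y) := ∫_{-1}^{1} G_k(y,y')·f(y') dy' satisfies ψ(-1) = ψ(1) = 0, ψ is continuously differentiable on [-1,1], and for every y ∈ (-1,1) the second derivative ψ''(y) exists and satisfies ψ''(y) - k²·ψ(y) = f(y). -/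
open Set

/-- The Green's function of `d²/dy² - k²` on `[-1,1]` with homogeneous Dirichlet
boundary conditions, for a nonzero integer `k`. -/
noncomputable def Gk (k : ℤ) (y y' : ℝ) : ℝ :=
  if y ≤ y' then
    -(Real.sinh ((k : ℝ) * (1 - y')) * Real.sinh ((k : ℝ) * (1 + y))) /
      ((k : ℝ) * Real.sinh (2 * (k : ℝ)))
  else
    -(Real.sinh ((k : ℝ) * (1 - y)) * Real.sinh ((k : ℝ) * (1 + y'))) /
      ((k : ℝ) * Real.sinh (2 * (k : ℝ)))

/-- The integral `∫ Gk k y y' * g y'` over `[-1,1]`, split at the kink `y' = y` of the kernel. -/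
noncomputable def greenSplit (k : ℤ) (g : ℝ → ℂ) (y : ℝ) : ℂ :=
  ((Real.sinh (k * (1 + y)) : ℂ) * (∫ t in (1:ℝ)..y, (Real.sinh (k * (1 - t)) : ℂ) * g t) -
    (Real.sinh (k * (1 - y)) : ℂ) * ∫ t in (-1:ℝ)..y, (Real.sinh (k * (1 + t)) : ℂ) * g t) /
      ((k : ℂ) * (Real.sinh (2 * k) : ℂ))

/-- The derivative of `greenSplit`. -/
noncomputable def greenSplitDeriv (k : ℤ) (g : ℝ → ℂ) (y : ℝ) : ℂ :=
  (k : ℂ) * ((Real.cosh (k * (1 + y)) : ℂ) *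
      (∫ t in (1:ℝ)..y, (Real.sinh (k * (1 - t)) : ℂ) * g t) +
    (Real.cosh (k * (1 - y)) : ℂ) * ∫ t in (-1:ℝ)..y, (Real.sinh (k * (1 + t)) : ℂ) * g t) /
      ((k : ℂ) * (Real.sinh (2 * k) : ℂ))

lemma hasDerivAt_mul_one_add (k y : ℝ) : HasDerivAt (fun y : ℝ => k * (1 + y)) k y := by
  simpa using ((hasDerivAt_id y).const_add 1).const_mul k

lemma hasDerivAt_mul_one_sub (k y : ℝ) : HasDerivAt (fun y : ℝ => k * (1 - y)) (-k) y := by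
  simpa using ((hasDerivAt_id y).const_sub 1).const_mul k

lemma hasDerivAt_integral_sinh_one_sub (k : ℤ) {g : ℝ → ℂ} (hg : Continuous g) (a y : ℝ) :
    HasDerivAt (fun y => ∫ t in a..y, (Real.sinh (k * (1 - t)) : ℂ) * g t)
      ((Real.sinh (k * (1 - y)) : ℂ) * g y) y := by
  have hc : Continuous fun t : ℝ => (Real.sinh (k * (1 - t)) : ℂ) * g t := by fun_prop
  exact hc.integral_hasStrictDerivAt a y |>.hasDerivAt

lemma hasDerivAt_integral_sinh_one_add (k : ℤ) {g : ℝ → ℂ} (hg : Continuous g) (a y : ℝ) :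
    HasDerivAt (fun y => ∫ t in a..y, (Real.sinh (k * (1 + t)) : ℂ) * g t)
      ((Real.sinh (k * (1 + y)) : ℂ) * g y) y := by
  have hc : Continuous fun t : ℝ => (Real.sinh (k * (1 + t)) : ℂ) * g t := by fun_prop
  exact hc.integral_hasStrictDerivAt a y |>.hasDerivAt

lemma hasDerivAt_greenSplit (k : ℤ) {g : ℝ → ℂ} (hg : Continuous g) (y : ℝ) :
    HasDerivAt (greenSplit k g) (greenSplitDeriv k g y) y := by
  have hadd := (hasDerivAt_mul_one_add k y).sinh.ofReal_comp
  have hsub := (hasDerivAt_mul_one_sub k y).sinh.ofReal_comp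
  have h := ((hadd.mul (hasDerivAt_integral_sinh_one_sub k hg 1 y)).sub
    (hsub.mul (hasDerivAt_integral_sinh_one_add k hg (-1) y))).div_const
      ((k : ℂ) * (Real.sinh (2 * k) : ℂ))
  refine h.congr_deriv ?_
  rw [greenSplitDeriv]
  congr 1
  push_cast
  ring

lemma hasDerivAt_greenSplitDeriv {k : ℤ} (hk : k ≠ 0) {g : ℝ → ℂ} (hg : Continuous g) (y : ℝ) :
    HasDerivAt (greenSplitDeriv k g) (g y + (k : ℂ) ^ 2 * greenSplit k g y) y := by
  have hadd := (hasDerivAt_mul_one_add k y).cosh.ofReal_comp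
  have hsub := (hasDerivAt_mul_one_sub k y).cosh.ofReal_comp
  have h := (((hadd.mul (hasDerivAt_integral_sinh_one_sub k hg 1 y)).add
    (hsub.mul (hasDerivAt_integral_sinh_one_add k hg (-1) y))).const_mul (k : ℂ)).div_const
      ((k : ℂ) * (Real.sinh (2 * k) : ℂ))
  refine h.congr_deriv ?_
  have hkC : (k : ℂ) ≠ 0 := Int.cast_ne_zero.mpr hk
  have hsinh : (Real.sinh (2 * k) : ℂ) ≠ 0 := by
    simpa only [ne_eq, Complex.ofReal_eq_zero, Real.sinh_eq_zero, mul_eq_zero, OfNat.ofNat_ne_zero,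
      false_or, Int.cast_eq_zero] using hk
  have hwronskian : (Real.sinh (2 * k) : ℂ) =
      (Real.sinh (k * (1 + y)) : ℂ) * (Real.cosh (k * (1 - y)) : ℂ) +
        (Real.cosh (k * (1 + y)) : ℂ) * (Real.sinh (k * (1 - y)) : ℂ) := by
    rw [← Complex.ofReal_mul, ← Complex.ofReal_mul, ← Complex.ofReal_add, ← Real.sinh_add]
    congr 2
    ring
  rw [greenSplit, div_eq_iff (mul_ne_zero hkC hsinh), add_mul, mul_assoc,
    div_mul_cancel₀ _ (mul_ne_zero hkC hsinh), hwronskian, Complex.ofReal_mul, Complex.ofReal_mul,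
    Complex.ofReal_neg, Complex.ofReal_intCast]
  ring

lemma contDiff_greenSplit {k : ℤ} (hk : k ≠ 0) {g : ℝ → ℂ} (hg : Continuous g) :
    ContDiff ℝ 1 (greenSplit k g) := by
  rw [contDiff_one_iff_deriv, funext fun y => (hasDerivAt_greenSplit k hg y).deriv]
  exact ⟨fun y => (hasDerivAt_greenSplit k hg y).differentiableAt,
    continuous_iff_continuousAt.mpr fun y => (hasDerivAt_greenSplitDeriv hk hg y).continuousAt⟩

lemma integral_Gk_mul_eq_greenSplit (k : ℤ) {g : ℝ → ℂ} (hg : Continuous g) {y : ℝ}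
    (hy : y ∈ Icc (-1 : ℝ) 1) :
    ∫ t in (-1:ℝ)..1, (Gk k y t : ℂ) * g t = greenSplit k g y := by
  set c : ℂ := (k : ℂ) * (Real.sinh (2 * k) : ℂ) with hc
  have hleft : EqOn (fun t => -(Real.sinh (k * (1 - y)) : ℂ) / c *
      ((Real.sinh (k * (1 + t)) : ℂ) * g t)) (fun t => (Gk k y t : ℂ) * g t) (uIoo (-1) y) := by
    intro t ht
    rw [uIoo_of_le hy.1] at ht
    simp only [Gk, if_neg ht.2.not_ge, hc]
    push_cast
    ring
  have hright : EqOn (fun t => -(Real.sinh (k * (1 + y)) : ℂ) / c *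
      ((Real.sinh (k * (1 - t)) : ℂ) * g t)) (fun t => (Gk k y t : ℂ) * g t) (uIoo y 1) := by
    intro t ht
    rw [uIoo_of_le hy.2] at ht
    simp only [Gk, if_pos ht.1.le, hc]
    push_cast
    ring
  have hleft_int := (Continuous.intervalIntegrable (μ := MeasureTheory.volume)
    (by fun_prop : Continuous fun t : ℝ => -(Real.sinh (k * (1 - y)) : ℂ) / c *
      ((Real.sinh (k * (1 + t)) : ℂ) * g t)) (-1) y).congr_uIoo hleft
  have hright_int := (Continuous.intervalIntegrable (μ := MeasureTheory.volume)
    (by fun_prop : Continuous fun t : ℝ => -(Real.sinh (k * (1 + y)) : ℂ) / c *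
      ((Real.sinh (k * (1 - t)) : ℂ) * g t)) y 1).congr_uIoo hright
  rw [← intervalIntegral.integral_add_adjacent_intervals hleft_int hright_int,
    ← intervalIntegral.integral_congr_uIoo hleft, ← intervalIntegral.integral_congr_uIoo hright,
    intervalIntegral.integral_const_mul, intervalIntegral.integral_const_mul, greenSplit, ← hc,
    intervalIntegral.integral_symm 1 y]
  ring

theorem stmt_1 (k : ℤ) (hk : k ≠ 0) (f : ℝ → ℂ) (hf : ContinuousOn f (Icc (-1) 1))
    (ψ : ℝ → ℂ) (hψ : ∀ y, ψ y = ∫ y' in (-1:ℝ)..1, (Gk k y y' : ℂ) * f y') :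
    ψ (-1) = 0 ∧ ψ 1 = 0 ∧ ContDiffOn ℝ 1 ψ (Icc (-1) 1) ∧
      ∀ y ∈ Ioo (-1:ℝ) 1, HasDerivAt (deriv ψ) (f y + (k : ℂ)^2 * ψ y) y := by
  have hle : (-1 : ℝ) ≤ 1 := by norm_num
  set g : ℝ → ℂ := IccExtend hle ((Icc (-1) 1).domRestrict f)
  have hg : Continuous g := hf.domRestrict.Icc_extend'
  have hgf : ∀ t ∈ Icc (-1 : ℝ) 1, g t = f t := fun t ht => IccExtend_of_mem hle _ ht
  have hψg : ∀ y ∈ Icc (-1 : ℝ) 1, ψ y = greenSplit k g y := by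
    intro y hy
    rw [hψ, ← integral_Gk_mul_eq_greenSplit k hg hy]
    refine intervalIntegral.integral_congr fun t ht => ?_
    rw [uIcc_of_le hle] at ht
    simp only [hgf t ht]
  refine ⟨?_, ?_, (contDiff_greenSplit hk hg).contDiffOn.congr hψg, fun y hy => ?_⟩
  · simp [hψg (-1) (left_mem_Icc.mpr hle), greenSplit]
  · simp [hψg 1 (right_mem_Icc.mpr hle), greenSplit]
  · have hderiv : EqOn (deriv ψ) (greenSplitDeriv k g) (Ioo (-1) 1) := fun x hx =>
      ((hasDerivAt_greenSplit k hg x).congr_of_eventuallyEq <|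
        (EqOn.mono Ioo_subset_Icc_self hψg).eventuallyEq_of_mem (Ioo_mem_nhds hx.1 hx.2)).deriv
    rw [← hgf y (Ioo_subset_Icc_self hy), hψg y (Ioo_subset_Icc_self hy)]
    exact (hasDerivAt_greenSplitDeriv hk hg y).congr_of_eventuallyEq
      (hderiv.eventuallyEq_of_mem (Ioo_mem_nhds hy.1 hy.2))
end

section
/- Let k be a nonzero integer and G_k as defined. Then for all y, y' ∈ [-1,1] with y ≠ y', the partial derivatives ∂_y G_k(y,y') and ∂_{y'} G_k(y,y') exist and satisfy |∂_y G_k(y,y')| ≤ 1 and |∂_{y'} G_k(y,y')| ≤ 1. -/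
open Set

theorem abs_sinh_mul_cosh_div_sinh_le_one {k : ℝ} (hk : k ≠ 0) {a b : ℝ}
    (hadd : |a + b| ≤ 2) (hsub : |a - b| ≤ 2) :
    |Real.sinh (k * a) * Real.cosh (k * b) / Real.sinh (2 * k)| ≤ 1 := by
  have bound : ∀ t : ℝ, |t| ≤ 2 → |Real.sinh (k * t)| ≤ |Real.sinh (2 * k)| := by
    intro t ht
    rw [Real.abs_sinh, Real.abs_sinh, Real.sinh_le_sinh, abs_mul, abs_mul, abs_two, mul_comm]
    gcongr
  have hpos : 0 < |Real.sinh (2 * k)| := by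
    rw [abs_pos, Ne, Real.sinh_eq_zero]
    simpa using hk
  have product : Real.sinh (k * a) * Real.cosh (k * b)
      = (Real.sinh (k * (a + b)) + Real.sinh (k * (a - b))) / 2 := by
    rw [mul_add, mul_sub, Real.sinh_add, Real.sinh_sub]
    ring
  rw [abs_div, div_le_one hpos, product, abs_div, abs_two]
  linarith [abs_add_le (Real.sinh (k * (a + b))) (Real.sinh (k * (a - b))),
    bound _ hadd, bound _ hsub]

theorem Gk_comm (k : ℤ) (y y' : ℝ) : Gk k y y' = Gk k y' y := by
  unfold Gk
  rcases lt_trichotomy y y' with h | rfl | h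
  · rw [if_pos h.le, if_neg h.not_ge]
  · rfl
  · rw [if_neg h.not_ge, if_pos h.le]

theorem exists_hasDerivAt_Gk_left (k : ℤ) (hk : k ≠ 0) {y y' : ℝ} (hy : y ∈ Icc (-1 : ℝ) 1)
    (hy' : y' ∈ Icc (-1 : ℝ) 1) (hne : y ≠ y') :
    ∃ d : ℝ, HasDerivAt (fun z => Gk k z y') d y ∧ |d| ≤ 1 := by
  obtain ⟨hy₁, hy₂⟩ := hy
  obtain ⟨hy₁', hy₂'⟩ := hy'
  have hk' : (k : ℝ) ≠ 0 := Int.cast_ne_zero.mpr hk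
  rcases hne.lt_or_gt with h | h
  · refine ⟨-(Real.sinh (k * (1 - y')) * Real.cosh (k * (1 + y)) / Real.sinh (2 * k)), ?_, ?_⟩
    · have hd := (((((hasDerivAt_id y).const_add 1).const_mul (k : ℝ)).sinh.const_mul
        (Real.sinh (k * (1 - y')))).neg).div_const (k * Real.sinh (2 * k))
      refine (hd.congr_of_eventuallyEq ?_).congr_deriv ?_
      · filter_upwards [eventually_lt_nhds h] with z hz
        simp [Gk, hz.le]
      · simp only [id]
        field_simp
    · rw [abs_neg]
      apply abs_sinh_mul_cosh_div_sinh_le_one hk' <;> rw [abs_le] <;> constructor <;> linarith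
  · refine ⟨Real.sinh (k * (1 + y')) * Real.cosh (k * (1 - y)) / Real.sinh (2 * k), ?_, ?_⟩
    · have hd := (((((hasDerivAt_id y).const_sub 1).const_mul (k : ℝ)).sinh.mul_const
        (Real.sinh (k * (1 + y')))).neg).div_const (k * Real.sinh (2 * k))
      refine (hd.congr_of_eventuallyEq ?_).congr_deriv ?_
      · filter_upwards [eventually_gt_nhds h] with z hz
        simp [Gk, hz.not_ge]
      · simp only [id]
        field_simp
    · apply abs_sinh_mul_cosh_div_sinh_le_one hk' <;> rw [abs_le] <;> constructor <;> linarith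

theorem stmt_2 (k : ℤ) (hk : k ≠ 0) :
    ∀ y ∈ Icc (-1:ℝ) 1, ∀ y' ∈ Icc (-1:ℝ) 1, y ≠ y' →
      (∃ d : ℝ, HasDerivAt (fun z => Gk k z y') d y ∧ |d| ≤ 1) ∧
      (∃ d : ℝ, HasDerivAt (fun z => Gk k y z) d y' ∧ |d| ≤ 1) := by
  intro y hy y' hy' hne
  refine ⟨exists_hasDerivAt_Gk_left k hk hy hy' hne, ?_⟩
  simp_rw [Gk_comm k y]
  exact exists_hasDerivAt_Gk_left k hk hy' hy hne.symm
end

section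
/- Let k be a nonzero integer and G_k as defined. Then for all y, y' ∈ [-1,1], |G_k(y,y')| ≤ 1/(2·|k|). -/
open Set

/-- For nonnegative arguments, `2 sinh a sinh b ≤ sinh (a + b)`. -/
theorem two_mul_sinh_mul_sinh_le_sinh_add {a b : ℝ} (ha : 0 ≤ a) (hb : 0 ≤ b) :
    2 * (Real.sinh a * Real.sinh b) ≤ Real.sinh (a + b) := by
  have hsa := Real.sinh_nonneg_iff.2 ha
  have hsb := Real.sinh_nonneg_iff.2 hb
  rw [Real.sinh_add]
  nlinarith [mul_le_mul_of_nonneg_left (Real.sinh_lt_cosh b).le hsa,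
    mul_le_mul_of_nonneg_right (Real.sinh_lt_cosh a).le hsb]

theorem abs_sinh_mul_sinh_div_le {κ a b : ℝ} (hκ : κ ≠ 0) (ha : 0 ≤ a) (hb : 0 ≤ b)
    (hab : a + b ≤ 2) :
    |-(Real.sinh (κ * a) * Real.sinh (κ * b)) / (κ * Real.sinh (2 * κ))| ≤
      1 / (2 * |κ|) := by
  have hκ' : 0 < |κ| := abs_pos.2 hκ
  have hs : 0 < Real.sinh (2 * |κ|) := Real.sinh_pos_iff.2 (by positivity)
  have hle : 2 * (Real.sinh (|κ| * a) * Real.sinh (|κ| * b)) ≤ Real.sinh (2 * |κ|) :=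
    (two_mul_sinh_mul_sinh_le_sinh_add (by positivity) (by positivity)).trans
      (Real.sinh_le_sinh.2 (by nlinarith))
  rw [abs_div, abs_neg, abs_mul, abs_mul, Real.abs_sinh, Real.abs_sinh, Real.abs_sinh,
    abs_mul, abs_mul, abs_mul, abs_of_nonneg ha, abs_of_nonneg hb, abs_two,
    div_le_div_iff₀ (by positivity) (by positivity)]
  nlinarith [mul_le_mul_of_nonneg_left hle hκ'.le]

theorem stmt_3 (k : ℤ) (hk : k ≠ 0) :
    ∀ y ∈ Icc (-1:ℝ) 1, ∀ y' ∈ Icc (-1:ℝ) 1,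
      |Gk k y y'| ≤ 1 / (2 * |(k : ℝ)|) := by
  intro y hy y' hy'
  have hk' : (k : ℝ) ≠ 0 := Int.cast_ne_zero.2 hk
  obtain ⟨hy₁, hy₂⟩ := hy
  obtain ⟨hy₁', hy₂'⟩ := hy'
  unfold Gk
  split_ifs with h
  · exact abs_sinh_mul_sinh_div_le hk' (by linarith) (by linarith) (by linarith)
  · exact abs_sinh_mul_sinh_div_le hk' (by linarith) (by linarith) (by linarith)
end

section
/- There exists a constant C > 0 such that the following holds. Let k be a nonzero integer, δ₀ > 0, and let U : [-1,1] → ℝ be twice continuously differentiable with |U''(y)| ≤ δ₀ for all y ∈ [-1,1]. Define K₁(y,y') := (y-y')·U''(y)·G_k(y,y'). Then (∬_{[-1,1]²} |K₁(y,y')|² dy dy')^{1/2} ≤ C·δ₀/k². -/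
open Set

/-- If `p`, `q`, `d` are nonnegative then `d * sinh p * sinh q ≤ sinh (p + q + d)`. -/
theorem mul_sinh_mul_sinh_le_sinh_add {p q d : ℝ} (hp : 0 ≤ p) (hq : 0 ≤ q) (hd : 0 ≤ d) :
    d * (Real.sinh p * Real.sinh q) ≤ Real.sinh (p + q + d) := by
  have sp := Real.sinh_nonneg_iff.2 hp
  have sq := Real.sinh_nonneg_iff.2 hq
  have sd := Real.sinh_nonneg_iff.2 hd
  have hdc : d ≤ Real.cosh d := (Real.self_le_sinh_iff.2 hd).trans (Real.sinh_lt_cosh d).le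
  have hpq : Real.sinh p * Real.sinh q ≤ Real.sinh (p + q) := by
    rw [Real.sinh_add]
    nlinarith [mul_le_mul_of_nonneg_left (Real.sinh_lt_cosh q).le sp,
      mul_nonneg (Real.cosh_pos p).le sq]
  rw [Real.sinh_add (p + q) d]
  calc d * (Real.sinh p * Real.sinh q) ≤ Real.cosh d * Real.sinh (p + q) :=
        mul_le_mul hdc hpq (mul_nonneg sp sq) (Real.cosh_pos d).le
    _ ≤ _ := by nlinarith [mul_nonneg (Real.cosh_pos (p + q)).le sd]

/-- The Green's function is even in the frequency. -/
theorem Gk_neg (k : ℤ) (y y' : ℝ) : Gk (-k) y y' = Gk k y y' := by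
  simp [Gk, Real.sinh_neg]

theorem abs_sub_mul_Gk_le_of_pos_of_le {k : ℤ} (hk : 0 < k) {y y' : ℝ} (hy : -1 ≤ y)
    (hy' : y' ≤ 1) (h : y ≤ y') : |(y - y') * Gk k y y'| ≤ 1 / (k : ℝ) ^ 2 := by
  have hk' : (0 : ℝ) < k := by exact_mod_cast hk
  have hp : 0 ≤ (k : ℝ) * (1 - y') := mul_nonneg hk'.le (by linarith)
  have hq : 0 ≤ (k : ℝ) * (1 + y) := mul_nonneg hk'.le (by linarith)
  have hd : 0 ≤ (k : ℝ) * (y' - y) := mul_nonneg hk'.le (by linarith)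
  have key := mul_sinh_mul_sinh_le_sinh_add hp hq hd
  rw [show (k : ℝ) * (1 - y') + k * (1 + y) + k * (y' - y) = 2 * k by ring] at key
  have hs : 0 < Real.sinh (2 * (k : ℝ)) := Real.sinh_pos_iff.2 (by positivity)
  have sp := Real.sinh_nonneg_iff.2 hp
  have sq := Real.sinh_nonneg_iff.2 hq
  have heq : (y - y') * Gk k y y' = (k : ℝ) * (y' - y) *
      (Real.sinh ((k : ℝ) * (1 - y')) * Real.sinh ((k : ℝ) * (1 + y))) /
      ((k : ℝ) ^ 2 * Real.sinh (2 * (k : ℝ))) := by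
    rw [Gk, if_pos h]
    field_simp
    ring
  rw [heq, abs_of_nonneg (by positivity), div_le_div_iff₀ (by positivity) (by positivity)]
  nlinarith [mul_le_mul_of_nonneg_left key (sq_nonneg (k : ℝ))]

theorem abs_sub_mul_Gk_le {k : ℤ} (hk : k ≠ 0) {y y' : ℝ} (hy : y ∈ Icc (-1 : ℝ) 1)
    (hy' : y' ∈ Icc (-1 : ℝ) 1) : |(y - y') * Gk k y y'| ≤ 1 / (k : ℝ) ^ 2 := by
  wlog hpos : 0 < k generalizing k
  · have := this (neg_ne_zero.2 hk) (by omega)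
    rwa [Gk_neg, Int.cast_neg, neg_sq] at this
  rcases le_total y y' with h | h
  · exact abs_sub_mul_Gk_le_of_pos_of_le hpos hy.1 hy'.2 h
  · have := abs_sub_mul_Gk_le_of_pos_of_le hpos hy'.1 hy.2 h
    rwa [Gk_comm, abs_mul, abs_sub_comm, ← abs_mul] at this

theorem stmt_6 :
    ∃ C : ℝ, 0 < C ∧ ∀ k : ℤ, k ≠ 0 → ∀ δ₀ : ℝ, 0 < δ₀ → ∀ U : ℝ → ℝ,
      ContDiffOn ℝ 2 U (Icc (-1) 1) →
      (∀ y ∈ Icc (-1:ℝ) 1, |deriv (deriv U) y| ≤ δ₀) →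
      Real.sqrt (∫ y in (-1:ℝ)..1, ∫ y' in (-1:ℝ)..1,
          ((y - y') * deriv (deriv U) y * Gk k y y')^2)
        ≤ C * δ₀ / (k : ℝ)^2 := by
  refine ⟨2, two_pos, fun k hk δ₀ hδ U _ hU => ?_⟩
  have hsub : ∀ y ∈ uIoc (-1 : ℝ) 1, y ∈ Icc (-1 : ℝ) 1 := fun y hy =>
    Ioc_subset_Icc_self (by rwa [uIoc_of_le (by norm_num)] at hy)
  have hpt : ∀ y ∈ uIoc (-1 : ℝ) 1, ∀ y' ∈ uIoc (-1 : ℝ) 1,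
      ‖((y - y') * deriv (deriv U) y * Gk k y y') ^ 2‖ ≤ (δ₀ / (k : ℝ) ^ 2) ^ 2 := by
    intro y hy y' hy'
    rw [norm_pow, Real.norm_eq_abs]
    refine pow_le_pow_left₀ (abs_nonneg _) ?_ 2
    rw [mul_right_comm, abs_mul, mul_comm]
    calc _ ≤ δ₀ * (1 / (k : ℝ) ^ 2) :=
          mul_le_mul (hU y (hsub y hy)) (abs_sub_mul_Gk_le hk (hsub y hy) (hsub y' hy'))
            (abs_nonneg _) hδ.le
      _ = _ := by ring
  have hint := intervalIntegral.norm_integral_le_of_norm_le_const fun y hy =>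
    intervalIntegral.norm_integral_le_of_norm_le_const (hpt y hy)
  refine Real.sqrt_le_iff.2 ⟨by positivity, (Real.le_norm_self _).trans (hint.trans_eq ?_)⟩
  rw [show |(1 : ℝ) - -1| = 2 by norm_num]
  ring
end

section
/- There exists a constant C > 0 such that the following holds. Let k be a nonzero integer, δ₀ > 0, and let U : [-1,1] → ℝ be three times continuously differentiable with |U''(y)| ≤ δ₀ and |U'''(y)| ≤ δ₀ for all y ∈ [-1,1]. Define K₁(y,y') := (y-y')·U''(y)·G_k(y,y'). Then the mixed partial derivative ∂_y ∂_{y'} K₁, defined for y ≠ y', satisfies (∬_{[-1,1]²} |∂_y ∂_{y'} K₁(y,y')|² dy dy')^{1/2} ≤ C·δ₀. -/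
open Set

/-- For `|k| ≥ 1`, the product `cosh (k a) * cosh (k b)` with `a + b + d = 2` is at most
`4 exp (-|k| d) * |sinh (2 k)|`. -/
lemma cosh_mul_cosh_le {k a b d : ℝ} (hk : 1 ≤ |k|) (ha : 0 ≤ a) (hb : 0 ≤ b)
    (h : a + b + d = 2) :
    Real.cosh (k * a) * Real.cosh (k * b) ≤
      4 * Real.exp (-(|k| * d)) * |Real.sinh (2 * k)| := by
  have cosh_le : ∀ x : ℝ, 0 ≤ x → Real.cosh (k * x) ≤ Real.exp (|k| * x) := by
    intro x hx
    rw [← Real.cosh_abs, abs_mul, abs_of_nonneg hx, Real.cosh_eq]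
    have : Real.exp (-(|k| * x)) ≤ Real.exp (|k| * x) :=
      Real.exp_le_exp.2 (by nlinarith [mul_nonneg (abs_nonneg k) hx])
    linarith
  have sinh_ge : Real.exp (2 * |k|) ≤ 4 * |Real.sinh (2 * k)| := by
    rw [Real.abs_sinh, abs_mul, abs_two, Real.sinh_eq]
    have h1 : Real.exp (-(2 * |k|)) ≤ 1 := Real.exp_le_one_iff.2 (by linarith)
    have h2 := Real.add_one_le_exp (2 * |k|)
    linarith
  calc Real.cosh (k * a) * Real.cosh (k * b)
      ≤ Real.exp (|k| * a) * Real.exp (|k| * b) :=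
        mul_le_mul (cosh_le a ha) (cosh_le b hb) (Real.cosh_pos _).le (Real.exp_pos _).le
    _ = Real.exp (-(|k| * d)) * Real.exp (2 * |k|) := by
        rw [← Real.exp_add, ← Real.exp_add]
        congr 1
        rw [← h]; ring
    _ ≤ Real.exp (-(|k| * d)) * (4 * |Real.sinh (2 * k)|) := by gcongr
    _ = _ := by ring

lemma abs_sinh_le_cosh (x : ℝ) : |Real.sinh x| ≤ Real.cosh x := by
  rw [Real.abs_sinh, ← Real.cosh_abs]
  exact (Real.sinh_lt_cosh _).le

/-- The mixed derivative of one smooth branch of the kernel. The sign `σ` selects the branch: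
`σ = 1` for `z < w` and `σ = -1` for `w < z`. -/
lemma hasDerivAt_deriv_branch {k σ c y y' V' : ℝ} {V : ℝ → ℝ} (hV : HasDerivAt V V' y) :
    HasDerivAt (fun z => deriv (fun w => (z - w) * V z *
        (c * (Real.sinh (k * (1 - σ * w)) * Real.sinh (k * (1 + σ * z))))) y')
      (V' * (c * Real.sinh (k * (1 + σ * y)) * (-Real.sinh (k * (1 - σ * y'))
          - (y - y') * (k * σ) * Real.cosh (k * (1 - σ * y'))))
        + V y * (c * (k * σ) * Real.cosh (k * (1 + σ * y)) * (-Real.sinh (k * (1 - σ * y'))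
          - (y - y') * (k * σ) * Real.cosh (k * (1 - σ * y')))
        - c * Real.sinh (k * (1 + σ * y)) * (k * σ) * Real.cosh (k * (1 - σ * y')))) y := by
  have hw : ∀ z, deriv (fun w => (z - w) * V z *
        (c * (Real.sinh (k * (1 - σ * w)) * Real.sinh (k * (1 + σ * z))))) y' =
      V z * (c * Real.sinh (k * (1 + σ * z)) * (-Real.sinh (k * (1 - σ * y'))
          - (z - y') * (k * σ) * Real.cosh (k * (1 - σ * y')))) := by
    intro z
    have h1 : HasDerivAt (fun w => k * (1 - σ * w)) (k * (-(σ * 1))) y' :=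
      (((hasDerivAt_id y').const_mul σ).const_sub 1).const_mul k
    have h2 := ((((hasDerivAt_id y').const_sub z).mul_const (V z)).mul
      ((h1.sinh.mul_const (Real.sinh (k * (1 + σ * z)))).const_mul c)).deriv
    refine Eq.trans h2 ?_
    simp only [id]
    ring
  simp only [hw]
  have h1 : HasDerivAt (fun z => k * (1 + σ * z)) (k * (σ * 1)) y :=
    (((hasDerivAt_id y).const_mul σ).const_add 1).const_mul k
  have h2 : HasDerivAt (fun z => -Real.sinh (k * (1 - σ * y'))
      - (z - y') * (k * σ) * Real.cosh (k * (1 - σ * y')))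
      (-(1 * (k * σ) * Real.cosh (k * (1 - σ * y')))) y :=
    ((((hasDerivAt_id y).sub_const y').mul_const (k * σ)).mul_const _).const_sub _
  refine (hV.mul ((h1.sinh.const_mul c).mul h2)).congr_deriv ?_
  simp only [Pi.mul_apply]
  ring

/-- The mixed derivative of a branch is bounded uniformly in `k` on the triangle where the branch
is used. -/
lemma abs_branch_le {k σ c y y' v v' δ : ℝ} (hk : 1 ≤ |k|) (hσ : |σ| = 1)
    (hc : |c| = (|k| * |Real.sinh (2 * k)|)⁻¹) (ha : 0 ≤ 1 - σ * y') (hb : 0 ≤ 1 + σ * y)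
    (hd : σ * (y' - y) = |y - y'|) (hd2 : |y - y'| ≤ 2) (hv : |v| ≤ δ) (hv' : |v'| ≤ δ) :
    |v' * (c * Real.sinh (k * (1 + σ * y)) * (-Real.sinh (k * (1 - σ * y'))
          - (y - y') * (k * σ) * Real.cosh (k * (1 - σ * y'))))
        + v * (c * (k * σ) * Real.cosh (k * (1 + σ * y)) * (-Real.sinh (k * (1 - σ * y'))
          - (y - y') * (k * σ) * Real.cosh (k * (1 - σ * y')))
        - c * Real.sinh (k * (1 + σ * y)) * (k * σ) * Real.cosh (k * (1 - σ * y')))|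
      ≤ 24 * δ := by
  have hE := cosh_mul_cosh_le (d := |y - y'|) hk ha hb (by rw [← hd]; ring)
  have hS := abs_sinh_le_cosh (k * (1 - σ * y'))
  have hT := abs_sinh_le_cosh (k * (1 + σ * y))
  have hCS := Real.cosh_pos (k * (1 - σ * y'))
  have hCT := Real.cosh_pos (k * (1 + σ * y))
  have hs : 0 < |Real.sinh (2 * k)| := by
    rw [abs_pos, Ne, Real.sinh_eq_zero]
    rintro h
    have : k = 0 := by linarith
    simp [this] at hk
    linarith
  have hδ : 0 ≤ δ := (abs_nonneg v).trans hv
  have hk0 : 0 < |k| := by linarith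
  set S := Real.sinh (k * (1 - σ * y'))
  set T := Real.sinh (k * (1 + σ * y))
  set CS := Real.cosh (k * (1 - σ * y'))
  set CT := Real.cosh (k * (1 + σ * y))
  set d := |y - y'| with hdd
  have hd0 : 0 ≤ d := abs_nonneg _
  have hcE : |c| * |k| * (CS * CT) ≤ 4 * Real.exp (-(|k| * d)) := by
    have : |c| * |k| = |Real.sinh (2 * k)|⁻¹ := by rw [hc]; field_simp
    rw [this, inv_mul_le_iff₀ hs]
    linarith
  have hexp : Real.exp (-(|k| * d)) ≤ 1 := Real.exp_le_one_iff.2 (by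
    have := mul_nonneg hk0.le hd0; linarith)
  have hexp' : |k| * d * Real.exp (-(|k| * d)) ≤ 1 := by
    rw [Real.exp_neg, mul_inv_le_iff₀ (Real.exp_pos _)]
    linarith [Real.add_one_le_exp (|k| * d)]
  have b1 : |c| * |k| * (CS * CT) ≤ 4 := by linarith
  have b2 : |c| * (CS * CT) ≤ 4 := by
    refine le_trans ?_ b1
    have : |c| ≤ |c| * |k| := le_mul_of_one_le_right (abs_nonneg c) hk
    gcongr
  have b3 : |k| * d * (|c| * |k| * (CS * CT)) ≤ 4 := by
    have := mul_le_mul_of_nonneg_left hcE (mul_nonneg hk0.le hd0)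
    linarith
  have e1 : |v' * (c * T * S)| ≤ δ * 4 := by
    rw [abs_mul, abs_mul, abs_mul]
    refine mul_le_mul hv' (le_trans ?_ b2) (by positivity) hδ
    calc |c| * |T| * |S| ≤ |c| * CT * CS := by gcongr
      _ = _ := by ring
  have e2 : |v' * (c * T * ((y - y') * (k * σ) * CS))| ≤ δ * 8 := by
    simp only [abs_mul, hσ, abs_of_pos hCS, ← hdd]
    refine mul_le_mul hv' ?_ (by positivity) hδ
    calc |c| * |T| * (d * (|k| * 1) * CS) ≤ |c| * CT * (2 * (|k| * 1) * CS) := by gcongr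
      _ = 2 * (|c| * |k| * (CS * CT)) := by ring
      _ ≤ 8 := by linarith
  have e3 : |v * (c * (k * σ) * CT * S)| ≤ δ * 4 := by
    simp only [abs_mul, hσ, abs_of_pos hCT]
    refine mul_le_mul hv (le_trans ?_ b1) (by positivity) hδ
    calc |c| * (|k| * 1) * CT * |S| ≤ |c| * (|k| * 1) * CT * CS := by gcongr
      _ = _ := by ring
  have e4 : |v * (c * (k * σ) * CT * ((y - y') * (k * σ) * CS))| ≤ δ * 4 := by
    simp only [abs_mul, hσ, abs_of_pos hCS, abs_of_pos hCT, ← hdd]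
    refine mul_le_mul hv (le_trans (le_of_eq ?_) b3) (by positivity) hδ
    ring
  have e5 : |v * (c * T * (k * σ) * CS)| ≤ δ * 4 := by
    simp only [abs_mul, hσ, abs_of_pos hCS]
    refine mul_le_mul hv (le_trans ?_ b1) (by positivity) hδ
    calc |c| * |T| * (|k| * 1) * CS ≤ |c| * CT * (|k| * 1) * CS := by gcongr
      _ = _ := by ring
  rw [abs_le] at *
  constructor <;> linarith

open Filter Topology in
/-- If `Gk` agrees with a branch near `(y, y')`, the mixed derivative of the kernel at `(y, y')`
is bounded by `24 δ`. -/
lemma abs_mixed_deriv_le_of_branch {k : ℤ} (hk : k ≠ 0) {σ y y' δ : ℝ} {V : ℝ → ℝ}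
    (hVd : DifferentiableAt ℝ V y) (hv : |V y| ≤ δ) (hv' : |deriv V y| ≤ δ)
    (hy : y ∈ Icc (-1 : ℝ) 1) (hy' : y' ∈ Icc (-1 : ℝ) 1) (hσ : σ = 1 ∨ σ = -1)
    (hd : 0 < σ * (y' - y))
    (hG : ∀ z w, 0 < σ * (w - z) → Gk k z w =
      -((k : ℝ) * Real.sinh (2 * k))⁻¹ *
        (Real.sinh (k * (1 - σ * w)) * Real.sinh (k * (1 + σ * z)))) :
    |deriv (fun z => deriv (fun w => (z - w) * V z * Gk k z w) y') y| ≤ 24 * δ := by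
  have hev : (fun z => deriv (fun w => (z - w) * V z * Gk k z w) y') =ᶠ[𝓝 y]
      fun z => deriv (fun w => (z - w) * V z * (-((k : ℝ) * Real.sinh (2 * k))⁻¹ *
        (Real.sinh (k * (1 - σ * w)) * Real.sinh (k * (1 + σ * z))))) y' := by
    have hz : ∀ᶠ z in 𝓝 y, 0 < σ * (y' - z) :=
      continuousAt_const.eventually_lt
        (by fun_prop : ContinuousAt (fun z => σ * (y' - z)) y) hd
    filter_upwards [hz] with z hz
    apply Filter.EventuallyEq.deriv_eq
    have hw : ∀ᶠ w in 𝓝 y', 0 < σ * (w - z) :=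
      continuousAt_const.eventually_lt
        (by fun_prop : ContinuousAt (fun w => σ * (w - z)) y') hz
    filter_upwards [hw] with w hw
    rw [hG z w hw]
  rw [hev.deriv_eq, (hasDerivAt_deriv_branch hVd.hasDerivAt).deriv]
  obtain ⟨h1, h2⟩ := hy
  obtain ⟨h3, h4⟩ := hy'
  have hk1 : (1 : ℝ) ≤ |(k : ℝ)| := by exact_mod_cast Int.one_le_abs hk
  refine abs_branch_le hk1 ?_ ?_ ?_ ?_ ?_ ?_ hv hv'
  · rcases hσ with rfl | rfl <;> simp
  · rw [abs_neg, abs_inv, abs_mul]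
  · rcases hσ with rfl | rfl <;> linarith
  · rcases hσ with rfl | rfl <;> linarith
  · rcases hσ with rfl | rfl
    · rw [abs_of_neg (by linarith)]; ring
    · rw [abs_of_pos (by linarith)]; ring
  · rw [abs_le]; constructor <;> linarith

lemma abs_mixed_deriv_le {k : ℤ} (hk : k ≠ 0) {y y' δ : ℝ} {V : ℝ → ℝ}
    (hVd : DifferentiableAt ℝ V y) (hv : |V y| ≤ δ) (hv' : |deriv V y| ≤ δ)
    (hy : y ∈ Icc (-1 : ℝ) 1) (hy' : y' ∈ Icc (-1 : ℝ) 1) (hne : y' ≠ y) :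
    |deriv (fun z => deriv (fun w => (z - w) * V z * Gk k z w) y') y| ≤ 24 * δ := by
  rcases lt_or_gt_of_ne hne with h | h
  · refine abs_mixed_deriv_le_of_branch (σ := -1) hk hVd hv hv' hy hy' (Or.inr rfl)
      (by linarith) fun z w hzw => ?_
    rw [Gk, if_neg (by linarith)]
    simp only [neg_mul, one_mul, sub_neg_eq_add, ← sub_eq_add_neg]
    ring
  · refine abs_mixed_deriv_le_of_branch (σ := 1) hk hVd hv hv' hy hy' (Or.inl rfl)
      (by linarith) fun z w hzw => ?_
    rw [Gk, if_pos (by linarith)]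
    simp only [one_mul]
    ring

lemma differentiableAt_deriv_deriv {U : ℝ → ℝ} {y : ℝ} (hU : ContDiffAt ℝ 3 U y) :
    DifferentiableAt ℝ (deriv (deriv U)) y := by
  have h1 : ContDiffAt ℝ 2 (deriv U) y := hU.derivWithin (m := 2) (by norm_num)
  have h2 : ContDiffAt ℝ 1 (deriv (deriv U)) y := h1.derivWithin (m := 1) (by norm_num)
  exact h2.differentiableAt (by norm_num)

theorem stmt_8 :
    ∃ C : ℝ, 0 < C ∧ ∀ k : ℤ, k ≠ 0 → ∀ δ₀ : ℝ, 0 < δ₀ → ∀ U : ℝ → ℝ,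
      ContDiffOn ℝ 3 U (Icc (-1) 1) →
      (∀ y ∈ Icc (-1:ℝ) 1, |deriv (deriv U) y| ≤ δ₀) →
      (∀ y ∈ Icc (-1:ℝ) 1, |deriv (deriv (deriv U)) y| ≤ δ₀) →
      Real.sqrt (∫ y in (-1:ℝ)..1, ∫ y' in (-1:ℝ)..1,
          (deriv (fun z =>
            deriv (fun w => (z - w) * deriv (deriv U) z * Gk k z w) y') y)^2)
        ≤ C * δ₀ := by
  refine ⟨48, by norm_num, fun k hk δ hδ U hU h2 h3 => ?_⟩
  have inner_le : ∀ᵐ y : ℝ, y ∈ uIoc (-1 : ℝ) 1 → ‖∫ y' in (-1:ℝ)..1,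
      (deriv (fun z =>
        deriv (fun w => (z - w) * deriv (deriv U) z * Gk k z w) y') y)^2‖
        ≤ (24 * δ) ^ 2 * |1 - (-1)| := by
    filter_upwards [MeasureTheory.Measure.ae_ne MeasureTheory.volume (1 : ℝ)] with y hy1 hy
    rw [uIoc_of_le (by norm_num)] at hy
    have hyI : y ∈ Icc (-1 : ℝ) 1 := Ioc_subset_Icc_self hy
    have hd := differentiableAt_deriv_deriv
      (hU.contDiffAt (Icc_mem_nhds hy.1 (lt_of_le_of_ne hy.2 hy1)))
    refine intervalIntegral.norm_integral_le_of_norm_le_const_ae ?_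
    filter_upwards [MeasureTheory.Measure.ae_ne MeasureTheory.volume y] with y' hne hy'
    rw [uIoc_of_le (by norm_num)] at hy'
    rw [Real.norm_eq_abs, abs_pow]
    exact pow_le_pow_left₀ (abs_nonneg _) (abs_mixed_deriv_le hk hd (h2 y hyI) (h3 y hyI) hyI
      (Ioc_subset_Icc_self hy') hne) 2
  have houter := intervalIntegral.norm_integral_le_of_norm_le_const_ae inner_le
  rw [Real.sqrt_le_left (by positivity)]
  refine (le_abs_self _).trans (houter.trans (le_of_eq ?_))
  norm_num
  ring
end

section
/- There exists a constant C > 0 such that the following holds. Let k be a nonzero integer, δ₀ > 0, and let U : [-1,1] → ℝ be three times continuously differentiable with |U'''(y)| ≤ δ₀ for all y ∈ [-1,1]. Define h(y,y') := (1/(y-y'))·∫_y^{y'} U'''(s)·(y'-s)² ds and K₂(y,y') := h(y,y')·G_k(y,y') for y ≠ y'. Then (∬_{[-1,1]²} |K₂(y,y')|² dy dy')^{1/2} ≤ C·δ₀/k², (∬_{[-1,1]²} |∂_y K₂(y,y')|² dy dy')^{1/2} + (∬_{[-1,1]²} |∂_{y'} K₂(y,y')|² dy dy')^{1/2} ≤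 C·δ₀/|k|, and (∬_{[-1,1]²} |∂_y ∂_{y'} K₂(y,y')|² dy dy')^{1/2} ≤ C·δ₀. -/
open Set

open Filter Topology

/-- Bounds for `dⁿ · 4 e^{-ad}/a` with `n = 0, 1, 2`. -/
theorem exp_profile_bounds {a d : ℝ} (ha : 1 ≤ a) (hd : 0 ≤ d) :
    4 * Real.exp (-(a * d)) / a ≤ 4 / a ∧
      d * (4 * Real.exp (-(a * d)) / a) ≤ 4 / a ^ 2 ∧
      d ^ 2 * (4 * Real.exp (-(a * d)) / a) ≤ 8 / a ^ 3 := by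
  have ha0 : 0 < a := by linarith
  have hx : 0 ≤ a * d := by positivity
  have hE : Real.exp (-(a * d)) = (Real.exp (a * d))⁻¹ := Real.exp_neg _
  have hpos := Real.exp_pos (a * d)
  have h0 : Real.exp (-(a * d)) ≤ 1 := Real.exp_le_one_iff.2 (by linarith)
  have h1 : a * d * Real.exp (-(a * d)) ≤ 1 := by
    rw [hE, ← div_eq_mul_inv, div_le_one hpos]
    linarith [Real.add_one_le_exp (a * d)]
  have h2 : (a * d) ^ 2 * Real.exp (-(a * d)) ≤ 2 := by
    rw [hE, ← div_eq_mul_inv, div_le_iff₀ hpos]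
    linarith [Real.quadratic_le_exp_of_nonneg hx]
  refine ⟨?_, ?_, ?_⟩
  · gcongr
    linarith
  · calc d * (4 * Real.exp (-(a * d)) / a)
        = 4 * (a * d * Real.exp (-(a * d))) / a ^ 2 := by field_simp
      _ ≤ 4 / a ^ 2 := by gcongr; linarith
  · calc d ^ 2 * (4 * Real.exp (-(a * d)) / a)
        = 4 * ((a * d) ^ 2 * Real.exp (-(a * d))) / a ^ 3 := by field_simp
      _ ≤ 8 / a ^ 3 := by gcongr; linarith

theorem exp_div_four_le_sinh {a : ℝ} (ha : 1 ≤ a) :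
    Real.exp (2 * a) / 4 ≤ Real.sinh (2 * a) := by
  rw [Real.sinh_eq]
  have h1 := Real.add_one_le_exp (2 * a)
  have h2 : Real.exp (-(2 * a)) ≤ 1 := Real.exp_le_one_iff.2 (by linarith)
  linarith

theorem abs_sinh_le_exp_abs (x : ℝ) : |Real.sinh x| ≤ Real.exp |x| := by
  rw [Real.abs_sinh, Real.sinh_eq]
  have := Real.exp_pos (-|x|)
  have := Real.exp_pos |x|
  linarith

theorem abs_cosh_le_exp_abs (x : ℝ) : |Real.cosh x| ≤ Real.exp |x| := by
  rw [abs_of_pos (Real.cosh_pos x), ← Real.cosh_abs, Real.cosh_eq]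
  have : Real.exp (-|x|) ≤ Real.exp |x| := Real.exp_le_exp.2 (by linarith [abs_nonneg x])
  linarith

/-- A product of two factors of exponential size divided by `κ sinh 2κ`. -/
theorem abs_mul_div_sinh_le {κ b c d u v : ℝ} (hκ : 1 ≤ |κ|) (hb : 0 ≤ b) (hc : 0 ≤ c)
    (hsum : b + c + d = 2) (hu : |u| ≤ Real.exp |κ * b|) (hv : |v| ≤ Real.exp |κ * c|) :
    |u * v / (κ * Real.sinh (2 * κ))| ≤ 4 * Real.exp (-(|κ| * d)) / |κ| := by
  have hκ0 : 0 < |κ| := by linarith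
  have hs : |Real.sinh (2 * κ)| = Real.sinh (2 * |κ|) := by
    rw [Real.abs_sinh, abs_mul, abs_two]
  have hle := exp_div_four_le_sinh hκ
  have hexp := Real.exp_pos (2 * |κ|)
  rw [abs_div, abs_mul, abs_mul, hs]
  rw [abs_mul, abs_of_nonneg hb] at hu
  rw [abs_mul, abs_of_nonneg hc] at hv
  calc |u| * |v| / (|κ| * Real.sinh (2 * |κ|))
      ≤ Real.exp (|κ| * b) * Real.exp (|κ| * c) / (|κ| * (Real.exp (2 * |κ|) / 4)) := by
        gcongr
    _ = 4 * Real.exp (-(|κ| * d)) / |κ| := by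
        have : Real.exp (|κ| * b) * Real.exp (|κ| * c)
            = Real.exp (2 * |κ|) * Real.exp (-(|κ| * d)) := by
          rw [← Real.exp_add, ← Real.exp_add]
          congr 1
          rw [← hsum]; ring
        rw [this]
        field_simp

section Remainder

variable {g : ℝ → ℝ} {δ : ℝ}

theorem hasDerivAt_integral_mul_sub_pow_left (hg : Continuous g) (n : ℕ) (y w : ℝ) :
    HasDerivAt (fun z => ∫ s in z..w, g s * (w - s) ^ n) (-(g y * (w - y) ^ n)) y := by
  have hc : Continuous fun s => g s * (w - s) ^ n := by fun_prop
  exact intervalIntegral.integral_hasDerivAt_left (hc.intervalIntegrable _ _)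
    (hc.stronglyMeasurableAtFilter _ _) hc.continuousAt

theorem hasDerivAt_integral_mul_sub_sq_right (hg : Continuous g) (y w : ℝ) :
    HasDerivAt (fun x => ∫ s in y..x, g s * (x - s) ^ 2)
      (2 * ∫ s in y..w, g s * (w - s) ^ 1) w := by
  have h0 : Continuous fun s => g s := hg
  have h1 : Continuous fun s => g s * s := by fun_prop
  have h2 : Continuous fun s => g s * s ^ 2 := by fun_prop
  have expand : (fun x => ∫ s in y..x, g s * (x - s) ^ 2) = fun x =>
      x ^ 2 * (∫ s in y..x, g s) - 2 * x * (∫ s in y..x, g s * s)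
        + ∫ s in y..x, g s * s ^ 2 := by
    funext x
    rw [← intervalIntegral.integral_const_mul, ← intervalIntegral.integral_const_mul,
      ← intervalIntegral.integral_sub, ← intervalIntegral.integral_add]
    · congr 1; funext s; ring
    all_goals exact Continuous.intervalIntegrable (by fun_prop) _ _
  have expand' : (∫ s in y..w, g s * (w - s) ^ 1) =
      w * (∫ s in y..w, g s) - ∫ s in y..w, g s * s := by
    rw [← intervalIntegral.integral_const_mul, ← intervalIntegral.integral_sub]
    · congr 1; funext s; ring
    all_goals exact Continuous.intervalIntegrable (by fun_prop) _ _
  have D : ∀ f : ℝ → ℝ, Continuous f → HasDerivAt (fun x => ∫ s in y..x, f s) (f w) w :=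
    fun f hf => intervalIntegral.integral_hasDerivAt_right (hf.intervalIntegrable _ _)
      (hf.stronglyMeasurableAtFilter _ _) hf.continuousAt
  rw [expand, expand']
  have hw := hasDerivAt_id w
  refine ((((hw.pow 2).mul (D _ h0)).sub ((hw.const_mul 2).mul (D _ h1))).add
    (D _ h2)).congr_deriv ?_
  simp
  ring

theorem abs_integral_mul_sub_pow_le (hδ : ∀ s, |g s| ≤ δ) (n : ℕ) (y w : ℝ) :
    |∫ s in y..w, g s * (w - s) ^ n| ≤ δ * |y - w| ^ (n + 1) := by
  have h := intervalIntegral.norm_integral_le_of_norm_le_const (a := y) (b := w)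
    (f := fun s => g s * (w - s) ^ n) (C := δ * |y - w| ^ n) ?_
  · rw [Real.norm_eq_abs, abs_sub_comm w y] at h
    exact h.trans_eq (by ring)
  · intro s hs
    rw [Real.norm_eq_abs, abs_mul, abs_pow]
    have : |w - s| ≤ |y - w| := by
      rw [abs_sub_comm y w]
      exact Set.abs_sub_right_of_mem_uIcc (Set.uIoc_subset_uIcc hs)
    have := (abs_nonneg _).trans (hδ s)
    gcongr
    exact hδ s

/-- The quotient `(y-w)⁻¹ ∫_y^w g(s)(w-s)² ds`. -/
noncomputable def remainderQuotient (g : ℝ → ℝ) (y w : ℝ) : ℝ :=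
  (1 / (y - w)) * ∫ s in y..w, g s * (w - s) ^ 2

/-- The derivative of `remainderQuotient` in the first variable. -/
noncomputable def remainderQuotientLeft (g : ℝ → ℝ) (y w : ℝ) : ℝ :=
  -(∫ s in y..w, g s * (w - s) ^ 2) / (y - w) ^ 2 - g y * (y - w)

/-- The derivative of `remainderQuotient` in the second variable. -/
noncomputable def remainderQuotientRight (g : ℝ → ℝ) (y w : ℝ) : ℝ :=
  (∫ s in y..w, g s * (w - s) ^ 2) / (y - w) ^ 2
    + 2 * (∫ s in y..w, g s * (w - s) ^ 1) / (y - w)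

/-- The mixed derivative of `remainderQuotient`. -/
noncomputable def remainderQuotientMixed (g : ℝ → ℝ) (y w : ℝ) : ℝ :=
  -2 * (∫ s in y..w, g s * (w - s) ^ 2) / (y - w) ^ 3
    - 2 * (∫ s in y..w, g s * (w - s) ^ 1) / (y - w) ^ 2 + g y

theorem hasDerivAt_remainderQuotient_left (hg : Continuous g) {y w : ℝ} (hyw : y ≠ w) :
    HasDerivAt (fun z => remainderQuotient g z w) (remainderQuotientLeft g y w) y := by
  have hne : y - w ≠ 0 := sub_ne_zero.2 hyw
  have hs : HasDerivAt (fun z => z - w) 1 y := (hasDerivAt_id y).sub_const w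
  unfold remainderQuotient remainderQuotientLeft
  refine (((hasDerivAt_const y (1 : ℝ)).div hs hne).mul
    (hasDerivAt_integral_mul_sub_pow_left hg 2 y w)).congr_deriv ?_
  simp only [Pi.div_apply]
  field_simp
  ring

theorem hasDerivAt_remainderQuotient_right (hg : Continuous g) {y w : ℝ} (hyw : y ≠ w) :
    HasDerivAt (fun x => remainderQuotient g y x) (remainderQuotientRight g y w) w := by
  have hne : y - w ≠ 0 := sub_ne_zero.2 hyw
  have hs : HasDerivAt (fun x => y - x) (-1) w := (hasDerivAt_id w).const_sub y
  unfold remainderQuotient remainderQuotientRight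
  refine (((hasDerivAt_const w (1 : ℝ)).div hs hne).mul
    (hasDerivAt_integral_mul_sub_sq_right hg y w)).congr_deriv ?_
  simp only [Pi.div_apply]
  field_simp
  ring

theorem hasDerivAt_remainderQuotientRight (hg : Continuous g) {y w : ℝ} (hyw : y ≠ w) :
    HasDerivAt (fun z => remainderQuotientRight g z w) (remainderQuotientMixed g y w) y := by
  have hne : y - w ≠ 0 := sub_ne_zero.2 hyw
  have hs : HasDerivAt (fun z => z - w) 1 y := (hasDerivAt_id y).sub_const w
  unfold remainderQuotientRight remainderQuotientMixed
  refine (((hasDerivAt_integral_mul_sub_pow_left hg 2 y w).div (hs.pow 2)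
    (pow_ne_zero 2 hne)).add
    (((hasDerivAt_integral_mul_sub_pow_left hg 1 y w).const_mul 2).div hs hne)).congr_deriv ?_
  simp only [Pi.pow_apply]
  field_simp
  ring

theorem abs_remainderQuotient_le (hδ : ∀ s, |g s| ≤ δ) {y w : ℝ} (hyw : y ≠ w) :
    |remainderQuotient g y w| ≤ δ * |y - w| ^ 2 := by
  have hd : 0 < |y - w| := abs_pos.2 (sub_ne_zero.2 hyw)
  have hI : |∫ s in y..w, g s * (w - s) ^ 2| ≤ δ * |y - w| ^ 3 :=
    abs_integral_mul_sub_pow_le hδ 2 y w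
  rw [remainderQuotient, abs_mul, abs_div, abs_one, one_div_mul_eq_div, div_le_iff₀ hd]
  exact hI.trans_eq (by ring)

theorem abs_remainderQuotientLeft_le (hδ : ∀ s, |g s| ≤ δ) {y w : ℝ} (hyw : y ≠ w) :
    |remainderQuotientLeft g y w| ≤ 2 * δ * |y - w| := by
  have hd : 0 < |y - w| := abs_pos.2 (sub_ne_zero.2 hyw)
  have hI : |∫ s in y..w, g s * (w - s) ^ 2| ≤ δ * |y - w| ^ 3 :=
    abs_integral_mul_sub_pow_le hδ 2 y w
  have h1 : |-(∫ s in y..w, g s * (w - s) ^ 2) / (y - w) ^ 2| ≤ δ * |y - w| := by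
    rw [abs_div, abs_neg, abs_pow, div_le_iff₀ (by positivity)]
    exact hI.trans_eq (by ring)
  have h2 : |g y * (y - w)| ≤ δ * |y - w| := by
    rw [abs_mul]
    gcongr
    exact hδ y
  rw [remainderQuotientLeft]
  linarith [abs_sub (-(∫ s in y..w, g s * (w - s) ^ 2) / (y - w) ^ 2) (g y * (y - w))]

theorem abs_remainderQuotientRight_le (hδ : ∀ s, |g s| ≤ δ) {y w : ℝ} (hyw : y ≠ w) :
    |remainderQuotientRight g y w| ≤ 3 * δ * |y - w| := by
  have hd : 0 < |y - w| := abs_pos.2 (sub_ne_zero.2 hyw)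
  have hI : |∫ s in y..w, g s * (w - s) ^ 2| ≤ δ * |y - w| ^ 3 :=
    abs_integral_mul_sub_pow_le hδ 2 y w
  have hJ : |∫ s in y..w, g s * (w - s) ^ 1| ≤ δ * |y - w| ^ 2 :=
    abs_integral_mul_sub_pow_le hδ 1 y w
  have h1 : |(∫ s in y..w, g s * (w - s) ^ 2) / (y - w) ^ 2| ≤ δ * |y - w| := by
    rw [abs_div, abs_pow, div_le_iff₀ (by positivity)]
    exact hI.trans_eq (by ring)
  have h2 : |2 * (∫ s in y..w, g s * (w - s) ^ 1) / (y - w)| ≤ 2 * δ * |y - w| := by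
    rw [abs_div, abs_mul, abs_two, div_le_iff₀ hd]
    linarith
  rw [remainderQuotientRight]
  exact (abs_add_le _ _).trans (by linarith)

theorem abs_remainderQuotientMixed_le (hδ : ∀ s, |g s| ≤ δ) {y w : ℝ} (hyw : y ≠ w) :
    |remainderQuotientMixed g y w| ≤ 5 * δ := by
  have hd : 0 < |y - w| := abs_pos.2 (sub_ne_zero.2 hyw)
  have hI : |∫ s in y..w, g s * (w - s) ^ 2| ≤ δ * |y - w| ^ 3 :=
    abs_integral_mul_sub_pow_le hδ 2 y w
  have hJ : |∫ s in y..w, g s * (w - s) ^ 1| ≤ δ * |y - w| ^ 2 :=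
    abs_integral_mul_sub_pow_le hδ 1 y w
  have h1 : |-2 * (∫ s in y..w, g s * (w - s) ^ 2) / (y - w) ^ 3| ≤ 2 * δ := by
    rw [abs_div, abs_mul, abs_neg, abs_two, abs_pow, div_le_iff₀ (by positivity)]
    linarith
  have h2 : |2 * (∫ s in y..w, g s * (w - s) ^ 1) / (y - w) ^ 2| ≤ 2 * δ := by
    rw [abs_div, abs_mul, abs_two, abs_pow, div_le_iff₀ (by positivity)]
    linarith
  rw [remainderQuotientMixed]
  refine (abs_add_le _ _).trans ?_
  linarith [abs_sub (-2 * (∫ s in y..w, g s * (w - s) ^ 2) / (y - w) ^ 3)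
    (2 * (∫ s in y..w, g s * (w - s) ^ 1) / (y - w) ^ 2), hδ y]

/-- Pointwise bounds for a kernel that is locally the product of `remainderQuotient g` with a
separated function `p(y) q(w)` decaying exponentially away from the diagonal. -/
theorem separated_kernel_bounds (hg : Continuous g) (hδ : ∀ s, |g s| ≤ δ)
    {p q p' q' : ℝ → ℝ} (hp : ∀ x, HasDerivAt p (p' x) x) (hq : ∀ x, HasDerivAt q (q' x) x)
    {K : ℝ → ℝ → ℝ} {y w a : ℝ} (hyw : y ≠ w) (ha : 1 ≤ a)
    (hK : ∀ᶠ x in 𝓝 (y, w), K x.1 x.2 = remainderQuotient g x.1 x.2 * (p x.1 * q x.2))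
    (hpq : |p y * q w| ≤ 4 * Real.exp (-(a * |y - w|)) / a)
    (hpq₁ : |p' y * q w| ≤ a * (4 * Real.exp (-(a * |y - w|)) / a))
    (hpq₂ : |p y * q' w| ≤ a * (4 * Real.exp (-(a * |y - w|)) / a))
    (hpq₃ : |p' y * q' w| ≤ a ^ 2 * (4 * Real.exp (-(a * |y - w|)) / a)) :
    |K y w| ≤ 8 * δ / a ^ 2 ∧ |deriv (fun z => K z w) y| ≤ 16 * δ / a ∧
      |deriv (fun x => K y x) w| ≤ 20 * δ / a ∧
      |deriv (fun z => deriv (fun x => K z x) w) y| ≤ 48 * δ := by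
  have ha0 : 0 < a := by linarith
  have hδ0 : 0 ≤ δ := (abs_nonneg _).trans (hδ 0)
  obtain ⟨hN0, hN1, hN2⟩ := exp_profile_bounds ha (abs_nonneg (y - w))
  have bH := abs_remainderQuotient_le hδ hyw
  have bL := abs_remainderQuotientLeft_le hδ hyw
  have bR := abs_remainderQuotientRight_le hδ hyw
  have bM := abs_remainderQuotientMixed_le hδ hyw
  set N := 4 * Real.exp (-(a * |y - w|)) / a
  set d := |y - w|
  have hKy : ∀ᶠ z in 𝓝 y, K z w = remainderQuotient g z w * (p z * q w) :=
    (Continuous.prodMk_left w).tendsto y |>.eventually hK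
  have hKw : ∀ᶠ z in 𝓝 y, ∀ᶠ x in 𝓝 w, K z x = remainderQuotient g z x * (p z * q x) := by
    rw [nhds_prod_eq] at hK
    exact hK.curry
  have dL : deriv (fun z => K z w) y = remainderQuotientLeft g y w * (p y * q w)
      + remainderQuotient g y w * (p' y * q w) := by
    rw [EventuallyEq.deriv_eq (f := fun z => remainderQuotient g z w * (p z * q w)) hKy]
    exact ((hasDerivAt_remainderQuotient_left hg hyw).mul ((hp y).mul_const _)).deriv
  have dR : ∀ᶠ z in 𝓝 y, deriv (fun x => K z x) w = remainderQuotientRight g z w * (p z * q w)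
      + remainderQuotient g z w * (p z * q' w) := by
    filter_upwards [hKw, isOpen_ne.mem_nhds hyw] with z hz hzw
    rw [EventuallyEq.deriv_eq (f := fun x => remainderQuotient g z x * (p z * q x)) hz]
    exact ((hasDerivAt_remainderQuotient_right hg hzw).mul ((hq w).const_mul _)).deriv
  have dM : deriv (fun z => deriv (fun x => K z x) w) y =
      (remainderQuotientMixed g y w * (p y * q w) + remainderQuotientRight g y w * (p' y * q w))
      + (remainderQuotientLeft g y w * (p y * q' w)
        + remainderQuotient g y w * (p' y * q' w)) := by
    rw [EventuallyEq.deriv_eq (f := fun z => remainderQuotientRight g z w * (p z * q w)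
      + remainderQuotient g z w * (p z * q' w)) dR]
    exact (((hasDerivAt_remainderQuotientRight hg hyw).mul ((hp y).mul_const _)).add
      ((hasDerivAt_remainderQuotient_left hg hyw).mul ((hp y).mul_const _))).deriv
  have mul_bd : ∀ {u v b c : ℝ}, |u| ≤ b → |v| ≤ c → |u * v| ≤ b * c := fun hu hv => by
    rw [abs_mul]
    exact mul_le_mul hu hv (abs_nonneg _) ((abs_nonneg _).trans hu)
  have inv1 : 1 / a ≤ 1 := (div_le_one ha0).2 ha
  have pow_inv : 1 / a ^ 2 ≤ 1 / a := by
    apply one_div_le_one_div_of_le ha0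
    nlinarith
  have pow_inv' : 1 / a ^ 3 ≤ 1 / a ^ 2 := by
    apply one_div_le_one_div_of_le (by positivity)
    exact pow_le_pow_right₀ ha (by norm_num)
  have e1 : δ * (d * N) ≤ 4 * (δ * (1 / a ^ 2)) :=
    (mul_le_mul_of_nonneg_left hN1 hδ0).trans_eq (by ring)
  have e2 : δ * (d ^ 2 * N) ≤ 8 * (δ * (1 / a ^ 3)) :=
    (mul_le_mul_of_nonneg_left hN2 hδ0).trans_eq (by ring)
  have e0 : δ * N ≤ 4 * (δ * (1 / a)) :=
    (mul_le_mul_of_nonneg_left hN0 hδ0).trans_eq (by ring)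
  have f0 : δ * (1 / a) ≤ δ * 1 := mul_le_mul_of_nonneg_left inv1 hδ0
  have f1 : δ * (1 / a ^ 2) ≤ δ * (1 / a) := mul_le_mul_of_nonneg_left pow_inv hδ0
  have f2 : δ * (1 / a ^ 3) ≤ δ * (1 / a ^ 2) := mul_le_mul_of_nonneg_left pow_inv' hδ0
  have ae1 : a * (δ * (d * N)) ≤ 4 * (δ * (1 / a)) :=
    (mul_le_mul_of_nonneg_left e1 ha0.le).trans_eq (by field_simp)
  have ae2 : a * (δ * (d ^ 2 * N)) ≤ 8 * (δ * (1 / a ^ 2)) :=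
    (mul_le_mul_of_nonneg_left e2 ha0.le).trans_eq (by field_simp)
  have aae2 : a ^ 2 * (δ * (d ^ 2 * N)) ≤ 8 * (δ * (1 / a)) :=
    (mul_le_mul_of_nonneg_left e2 (by positivity)).trans_eq (by field_simp)
  clear_value N d
  rw [show 8 * δ / a ^ 2 = 8 * (δ * (1 / a ^ 2)) by ring,
    show 16 * δ / a = 16 * (δ * (1 / a)) by ring,
    show 20 * δ / a = 20 * (δ * (1 / a)) by ring]
  generalize δ * (1 / a) = r₁ at *
  generalize δ * (1 / a ^ 2) = r₂ at *
  generalize δ * (1 / a ^ 3) = r₃ at *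
  refine ⟨?_, ?_, ?_, ?_⟩
  · rw [show K y w = _ from hK.self_of_nhds]
    refine (mul_bd bH hpq).trans ?_
    linarith
  · rw [dL]
    refine (abs_add_le _ _).trans ((add_le_add (mul_bd bL hpq) (mul_bd bH hpq₁)).trans ?_)
    linarith
  · rw [dR.self_of_nhds]
    refine (abs_add_le _ _).trans ((add_le_add (mul_bd bR hpq) (mul_bd bH hpq₂)).trans ?_)
    linarith
  · rw [dM]
    refine (abs_add_le _ _).trans ((add_le_add
      ((abs_add_le _ _).trans (add_le_add (mul_bd bM hpq) (mul_bd bR hpq₁)))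
      ((abs_add_le _ _).trans (add_le_add (mul_bd bL hpq₂) (mul_bd bH hpq₃)))).trans ?_)
    linarith

end Remainder

theorem hasDerivAt_sinh_mul_one_add (κ x : ℝ) :
    HasDerivAt (fun x => Real.sinh (κ * (1 + x))) (κ * Real.cosh (κ * (1 + x))) x := by
  refine (((hasDerivAt_id x).const_add 1).const_mul κ).sinh.congr_deriv ?_
  simp only [id_eq]
  ring

theorem hasDerivAt_sinh_mul_one_sub (κ x : ℝ) :
    HasDerivAt (fun x => Real.sinh (κ * (1 - x))) (-κ * Real.cosh (κ * (1 - x))) x := by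
  refine (((hasDerivAt_id x).const_sub 1).const_mul κ).sinh.congr_deriv ?_
  simp only [id_eq]
  ring

theorem kernel_bounds {g : ℝ → ℝ} {δ : ℝ} (hg : Continuous g) (hδ : ∀ s, |g s| ≤ δ) {k : ℤ}
    (hk : k ≠ 0) {K : ℝ → ℝ → ℝ}
    (hK : ∀ y ∈ Ioo (-1 : ℝ) 1, ∀ w ∈ Ioo (-1 : ℝ) 1,
      K y w = remainderQuotient g y w * Gk k y w)
    {y w : ℝ} (hy : y ∈ Ioo (-1 : ℝ) 1) (hw : w ∈ Ioo (-1 : ℝ) 1) (hyw : y ≠ w) :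
    |K y w| ≤ 8 * δ / |(k : ℝ)| ^ 2 ∧ |deriv (fun z => K z w) y| ≤ 16 * δ / |(k : ℝ)| ∧
      |deriv (fun x => K y x) w| ≤ 20 * δ / |(k : ℝ)| ∧
      |deriv (fun z => deriv (fun x => K z x) w) y| ≤ 48 * δ := by
  have hκ : 1 ≤ |(k : ℝ)| := by exact_mod_cast Int.one_le_abs hk
  have hnear : ∀ᶠ x : ℝ × ℝ in 𝓝 (y, w), x.1 ∈ Ioo (-1 : ℝ) 1 ∧ x.2 ∈ Ioo (-1 : ℝ) 1 :=
    prod_mem_nhds (Ioo_mem_nhds hy.1 hy.2) (Ioo_mem_nhds hw.1 hw.2)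
  simp only [Gk] at hK
  generalize (k : ℝ) = κ at hκ hK ⊢
  set c : ℝ := κ * Real.sinh (2 * κ)
  have hκN : ∀ {t N : ℝ}, |t| ≤ N → |κ * t| ≤ |κ| * N := fun h => by
    rw [abs_mul]; gcongr
  have hκκN : ∀ {t N : ℝ}, |t| ≤ N → |κ ^ 2 * t| ≤ |κ| ^ 2 * N := fun h => by
    rw [abs_mul, abs_pow]; gcongr
  rcases lt_or_gt_of_ne hyw with hlt | hlt
  · have key : ∀ u v : ℝ, |u| ≤ Real.exp |κ * (1 - w)| → |v| ≤ Real.exp |κ * (1 + y)| →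
        |u * v / c| ≤ 4 * Real.exp (-(|κ| * |y - w|)) / |κ| := fun u v =>
      abs_mul_div_sinh_le hκ (by linarith [hw.2]) (by linarith [hy.1])
        (by rw [abs_of_neg (by linarith)]; ring)
    have hs := abs_sinh_le_exp_abs (κ * (1 - w))
    have hc := abs_cosh_le_exp_abs (κ * (1 - w))
    have hs' := abs_sinh_le_exp_abs (κ * (1 + y))
    have hc' := abs_cosh_le_exp_abs (κ * (1 + y))
    refine separated_kernel_bounds hg hδ
      (p := fun x => Real.sinh (κ * (1 + x)))
      (p' := fun x => κ * Real.cosh (κ * (1 + x)))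
      (q := fun x => -(Real.sinh (κ * (1 - x)) / c))
      (q' := fun x => -(-κ * Real.cosh (κ * (1 - x)) / c))
      (hasDerivAt_sinh_mul_one_add κ)
      (fun x => ((hasDerivAt_sinh_mul_one_sub κ x).div_const c).neg) hyw hκ ?_ ?_ ?_ ?_ ?_
    · filter_upwards [hnear, (isOpen_lt continuous_fst continuous_snd).mem_nhds hlt]
        with x hx hlt'
      rw [hK _ hx.1 _ hx.2, if_pos (le_of_lt hlt')]
      ring
    · rw [← abs_neg]
      exact (congrArg abs (by ring)).trans_le (key _ _ hs hs')
    · rw [← abs_neg]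
      exact (congrArg abs (by ring)).trans_le (hκN (key _ _ hs hc'))
    · exact (congrArg abs (by ring)).trans_le (hκN (key _ _ hc hs'))
    · exact (congrArg abs (by ring)).trans_le (hκκN (key _ _ hc hc'))
  · have key : ∀ u v : ℝ, |u| ≤ Real.exp |κ * (1 - y)| → |v| ≤ Real.exp |κ * (1 + w)| →
        |u * v / c| ≤ 4 * Real.exp (-(|κ| * |y - w|)) / |κ| := fun u v =>
      abs_mul_div_sinh_le hκ (by linarith [hy.2]) (by linarith [hw.1])
        (by rw [abs_of_pos (by linarith)]; ring)
    have hs := abs_sinh_le_exp_abs (κ * (1 - y))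
    have hc := abs_cosh_le_exp_abs (κ * (1 - y))
    have hs' := abs_sinh_le_exp_abs (κ * (1 + w))
    have hc' := abs_cosh_le_exp_abs (κ * (1 + w))
    refine separated_kernel_bounds hg hδ
      (q := fun x => Real.sinh (κ * (1 + x)))
      (q' := fun x => κ * Real.cosh (κ * (1 + x)))
      (p := fun x => -(Real.sinh (κ * (1 - x)) / c))
      (p' := fun x => -(-κ * Real.cosh (κ * (1 - x)) / c))
      (fun x => ((hasDerivAt_sinh_mul_one_sub κ x).div_const c).neg)
      (hasDerivAt_sinh_mul_one_add κ) hyw hκ ?_ ?_ ?_ ?_ ?_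
    · filter_upwards [hnear, (isOpen_lt continuous_snd continuous_fst).mem_nhds hlt]
        with x hx hlt'
      rw [hK _ hx.1 _ hx.2, if_neg (not_le_of_gt hlt')]
      ring
    · rw [← abs_neg]
      exact (congrArg abs (by ring)).trans_le (key _ _ hs hs')
    · exact (congrArg abs (by ring)).trans_le (hκN (key _ _ hc hs'))
    · rw [← abs_neg]
      exact (congrArg abs (by ring)).trans_le (hκN (key _ _ hs hc'))
    · exact (congrArg abs (by ring)).trans_le (hκκN (key _ _ hc hc'))

/-- The third derivative of a `C³` function on `[-1,1]` bounded by `δ` agrees on `(-1,1)` with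
a continuous function on the line with the same bound. -/
theorem exists_continuous_extension_deriv_three {U : ℝ → ℝ} {δ : ℝ} (hδ : 0 < δ)
    (hU : ContDiffOn ℝ 3 U (Icc (-1) 1))
    (hb : ∀ y ∈ Icc (-1 : ℝ) 1, |deriv (deriv (deriv U)) y| ≤ δ) :
    ∃ g : ℝ → ℝ, Continuous g ∧ (∀ s, |g s| ≤ δ) ∧
      ∀ s ∈ Ioo (-1 : ℝ) 1, g s = deriv (deriv (deriv U)) s := by
  have hlt : (-1 : ℝ) < 1 := by norm_num
  set f := iteratedDerivWithin 3 U (Icc (-1) 1)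
  have hf : ContinuousOn f (Icc (-1) 1) :=
    hU.continuousOn_iteratedDerivWithin le_rfl (uniqueDiffOn_Icc hlt)
  have heq : ∀ s ∈ Ioo (-1 : ℝ) 1, f s = deriv (deriv (deriv U)) s := by
    intro s hs
    have h1 : f s = iteratedDeriv 3 U s :=
      iteratedDerivWithin_eq_iteratedDeriv (uniqueDiffOn_Icc hlt)
        (hU.contDiffAt (Icc_mem_nhds hs.1 hs.2)) (Ioo_subset_Icc_self hs)
    rw [h1, iteratedDeriv_succ, iteratedDeriv_succ, iteratedDeriv_one]
  refine ⟨fun s => max (-δ) (min δ (IccExtend hlt.le ((Icc (-1 : ℝ) 1).domRestrict f) s)),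
    ?_, fun s => abs_le.2 ⟨le_max_left _ _, max_le (by linarith) (min_le_left _ _)⟩, ?_⟩
  · exact continuous_const.max (continuous_const.min
      (continuousOn_iff_continuous_domRestrict.1 hf).Icc_extend')
  · intro s hs
    have hs' := Ioo_subset_Icc_self hs
    have hbs := abs_le.1 (hb s hs')
    simp only [IccExtend_of_mem hlt.le _ hs', domRestrict_apply, heq s hs]
    rw [min_eq_right hbs.2, max_eq_right hbs.1]

theorem sqrt_integral_integral_sq_le {F : ℝ → ℝ → ℝ} {M : ℝ} (hM : 0 ≤ M)
    (hF : ∀ y ∈ Ioo (-1 : ℝ) 1, ∀ w ∈ Ioo (-1 : ℝ) 1, y ≠ w → |F y w| ≤ M) :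
    Real.sqrt (∫ y in (-1 : ℝ)..1, ∫ w in (-1 : ℝ)..1, (F y w) ^ 2) ≤ 2 * M := by
  have mem : ∀ x : ℝ, x ∈ uIoc (-1 : ℝ) 1 → x ≠ 1 → x ∈ Ioo (-1 : ℝ) 1 := by
    intro x hx hx1
    rw [uIoc_of_le (by norm_num)] at hx
    exact ⟨hx.1, lt_of_le_of_ne hx.2 hx1⟩
  have inner : ∀ y ∈ Ioo (-1 : ℝ) 1, ‖∫ w in (-1 : ℝ)..1, (F y w) ^ 2‖ ≤ M ^ 2 * |1 - (-1 : ℝ)| := by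
    intro y hy
    apply intervalIntegral.norm_integral_le_of_norm_le_const_ae
    filter_upwards [MeasureTheory.Measure.ae_ne MeasureTheory.volume (1 : ℝ),
      MeasureTheory.Measure.ae_ne MeasureTheory.volume y] with w hw1 hwy hw
    rw [norm_pow]
    gcongr
    exact hF y hy w (mem w hw hw1) hwy.symm
  have outer : ‖∫ y in (-1 : ℝ)..1, ∫ w in (-1 : ℝ)..1, (F y w) ^ 2‖
      ≤ M ^ 2 * |1 - (-1 : ℝ)| * |1 - (-1 : ℝ)| := by
    apply intervalIntegral.norm_integral_le_of_norm_le_const_ae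
    filter_upwards [MeasureTheory.Measure.ae_ne MeasureTheory.volume (1 : ℝ)] with y hy1 hy
    exact inner y (mem y hy hy1)
  apply Real.sqrt_le_iff.2 ⟨by positivity, (Real.le_norm_self _).trans (outer.trans_eq ?_)⟩
  norm_num
  ring

theorem stmt_9 :
    ∃ C : ℝ, 0 < C ∧ ∀ k : ℤ, k ≠ 0 → ∀ δ₀ : ℝ, 0 < δ₀ → ∀ U : ℝ → ℝ,
      ContDiffOn ℝ 3 U (Icc (-1) 1) →
      (∀ y ∈ Icc (-1:ℝ) 1, |deriv (deriv (deriv U)) y| ≤ δ₀) →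
      ∀ h K₂ : ℝ → ℝ → ℝ,
      (∀ y y' : ℝ, h y y' =
        (1 / (y - y')) * ∫ s in y..y', deriv (deriv (deriv U)) s * (y' - s)^2) →
      (∀ y y' : ℝ, K₂ y y' = h y y' * Gk k y y') →
      Real.sqrt (∫ y in (-1:ℝ)..1, ∫ y' in (-1:ℝ)..1, (K₂ y y')^2)
          ≤ C * δ₀ / (k : ℝ)^2 ∧
        Real.sqrt (∫ y in (-1:ℝ)..1, ∫ y' in (-1:ℝ)..1,
            (deriv (fun z => K₂ z y') y)^2)
          + Real.sqrt (∫ y in (-1:ℝ)..1, ∫ y' in (-1:ℝ)..1,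
            (deriv (fun w => K₂ y w) y')^2)
          ≤ C * δ₀ / |(k : ℝ)| ∧
        Real.sqrt (∫ y in (-1:ℝ)..1, ∫ y' in (-1:ℝ)..1,
            (deriv (fun z => deriv (fun w => K₂ z w) y') y)^2)
          ≤ C * δ₀ := by
  refine ⟨96, by norm_num, fun k hk δ₀ hδ₀ U hU hb h K₂ hh hK₂ => ?_⟩
  obtain ⟨g, hg, hgδ, hgU⟩ := exists_continuous_extension_deriv_three hδ₀ hU hb
  have hK : ∀ y ∈ Ioo (-1 : ℝ) 1, ∀ w ∈ Ioo (-1 : ℝ) 1,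
      K₂ y w = remainderQuotient g y w * Gk k y w := by
    intro y hy w hw
    rw [hK₂, hh, remainderQuotient]
    congr 2
    refine intervalIntegral.integral_congr fun s hs => ?_
    simp only [hgU s (ordConnected_Ioo.uIcc_subset hy hw hs)]
  have hκ : 0 < |(k : ℝ)| := abs_pos.2 (Int.cast_ne_zero.2 hk)
  have bounds := fun y hy w hw hyw => kernel_bounds hg hgδ hk hK (y := y) (w := w) hy hw hyw
  have b0 := sqrt_integral_integral_sq_le (by positivity)
    fun y hy w hw hyw => (bounds y hy w hw hyw).1
  have b1 := sqrt_integral_integral_sq_le (F := fun y w => deriv (fun z => K₂ z w) y)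
    (by positivity) fun y hy w hw hyw => (bounds y hy w hw hyw).2.1
  have b2 := sqrt_integral_integral_sq_le (F := fun y w => deriv (fun x => K₂ y x) w)
    (by positivity) fun y hy w hw hyw => (bounds y hy w hw hyw).2.2.1
  have b3 := sqrt_integral_integral_sq_le
    (F := fun y w => deriv (fun z => deriv (fun x => K₂ z x) w) y)
    (by positivity) fun y hy w hw hyw => (bounds y hy w hw hyw).2.2.2
  refine ⟨b0.trans ?_, (add_le_add b1 b2).trans ?_, b3.trans_eq (by ring)⟩
  · rw [sq_abs, ← mul_div_assoc]
    exact div_le_div_of_nonneg_right (by linarith) (by positivity)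
  · rw [← mul_div_assoc, ← mul_div_assoc, ← add_div]
    exact div_le_div_of_nonneg_right (by linarith) hκ.le
end

section
/- Let ν ∈ (0,1], δ₀ ∈ (0,1/2), and let k be a nonzero integer. Let U : [0,∞) × [-1,1] → ℝ be smooth with |∂_y U(t,y) - 1| ≤ δ₀ for all t ≥ 0 and y ∈ [-1,1]. Let θ : [0,∞) × [-1,1] → ℂ be smooth, with θ(t,-1) = θ(t,1) = 0 for all t ≥ 0, satisfying ∂_t θ(t,y) + i·k·U(t,y)·θ(t,y) - ν·∂_y² θ(t,y) = 0 for all t ≥ 0, y ∈ [-1,1]. Define E(t) := 16·‖θ(t,·)‖²_{L²} + ν^{2/3}·|k|^{-2/3}·‖∂_y θ(t,·)‖²_{L²} + ν^{1/3}·|k|^{-4/3}·Re⟨i·k·θ(t,·), ∂_y θ(t,·)⟩. Then E is differentiable and for every t ≥ 0: E'(t) + (1/4)·ν^{1/3}·|k|^{2/3}·‖θ(t,·)‖²_{L²} + ν·‖∂_y θ(t,·)‖²_{L²} + ν^{5/3}·|k|^{-2/3}·‖∂_y² θ(t,·)‖²_{L²} ≤ 0. -/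
open Set

section PartialDerivatives

variable {F : Type*} [NormedAddCommGroup F] [NormedSpace ℝ F] {f : ℝ → ℝ → F}

theorem hasDerivAt_fst_of_contDiff (hf : ContDiff ℝ (⊤ : ℕ∞) (Function.uncurry f)) (t y : ℝ) :
    HasDerivAt (fun s => f s y) (fderiv ℝ (Function.uncurry f) (t, y) (1, 0)) t := by
  have h := (hf.differentiable (by simp) (t, y)).hasFDerivAt
  exact h.comp_hasDerivAt t ((hasDerivAt_id t).prodMk (hasDerivAt_const t y))

theorem hasDerivAt_snd_of_contDiff (hf : ContDiff ℝ (⊤ : ℕ∞) (Function.uncurry f)) (t y : ℝ) :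
    HasDerivAt (f t) (fderiv ℝ (Function.uncurry f) (t, y) (0, 1)) y := by
  have h := (hf.differentiable (by simp) (t, y)).hasFDerivAt
  exact h.comp_hasDerivAt y ((hasDerivAt_const y t).prodMk (hasDerivAt_id y))

theorem contDiff_uncurry_deriv_fst (hf : ContDiff ℝ (⊤ : ℕ∞) (Function.uncurry f)) :
    ContDiff ℝ (⊤ : ℕ∞) (Function.uncurry fun t y => deriv (fun s => f s y) t) := by
  have h : (Function.uncurry fun t y => deriv (fun s => f s y) t)
      = fun z => fderiv ℝ (Function.uncurry f) z (1, 0) :=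
    funext fun z => (hasDerivAt_fst_of_contDiff hf z.1 z.2).deriv
  rw [h]
  exact (hf.fderiv_right (by simp)).clm_apply contDiff_const

theorem contDiff_uncurry_deriv_snd (hf : ContDiff ℝ (⊤ : ℕ∞) (Function.uncurry f)) :
    ContDiff ℝ (⊤ : ℕ∞) (Function.uncurry fun t y => deriv (f t) y) := by
  have h : (Function.uncurry fun t y => deriv (f t) y)
      = fun z => fderiv ℝ (Function.uncurry f) z (0, 1) :=
    funext fun z => (hasDerivAt_snd_of_contDiff hf z.1 z.2).deriv
  rw [h]
  exact (hf.fderiv_right (by simp)).clm_apply contDiff_const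

theorem deriv_deriv_comm_of_contDiff (hf : ContDiff ℝ (⊤ : ℕ∞) (Function.uncurry f)) (t y : ℝ) :
    deriv (fun s => deriv (f s) y) t = deriv (fun x => deriv (fun s => f s x) t) y := by
  have h1 := (hasDerivAt_fst_of_contDiff (contDiff_uncurry_deriv_snd hf) t y).deriv
  have h2 := (hasDerivAt_snd_of_contDiff (contDiff_uncurry_deriv_fst hf) t y).deriv
  have e1 : (Function.uncurry fun t y => deriv (f t) y)
      = fun z => fderiv ℝ (Function.uncurry f) z (0, 1) :=
    funext fun z => (hasDerivAt_snd_of_contDiff hf z.1 z.2).deriv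
  have e2 : (Function.uncurry fun t y => deriv (fun s => f s y) t)
      = fun z => fderiv ℝ (Function.uncurry f) z (1, 0) :=
    funext fun z => (hasDerivAt_fst_of_contDiff hf z.1 z.2).deriv
  have hd : DifferentiableAt ℝ (fderiv ℝ (Function.uncurry f)) (t, y) :=
    (hf.fderiv_right (m := (⊤ : ℕ∞)) (by simp)).differentiable (by simp) (t, y)
  rw [h1, h2, e1, e2, fderiv_clm_apply hd (by fun_prop), fderiv_clm_apply hd (by fun_prop)]
  simpa using hf.contDiffAt.isSymmSndFDerivAt
    (by simpa using WithTop.coe_le_coe.2 (le_top : (2 : ℕ∞) ≤ ⊤))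
    (1, 0) (0, 1)

theorem hasDerivAt_intervalIntegral_of_contDiff
    (hf : ContDiff ℝ (⊤ : ℕ∞) (Function.uncurry f)) (a b t : ℝ) :
    HasDerivAt (fun s => ∫ y in a..b, f s y) (∫ y in a..b, deriv (fun s => f s y) t) t := by
  have hft := (contDiff_uncurry_deriv_fst hf).continuous
  obtain ⟨C, hC⟩ := ((isCompact_Icc (a := t - 1) (b := t + 1)).prod
    (isCompact_uIcc (a := a) (b := b))).exists_bound_of_continuousOn hft.continuousOn
  refine (intervalIntegral.hasDerivAt_integral_of_dominated_loc_of_deriv_le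
    (F' := fun s y => deriv (fun r => f r y) s) (bound := fun _ => C)
    (Icc_mem_nhds (by linarith) (by linarith) : Icc (t - 1) (t + 1) ∈ nhds t)
    (.of_forall fun s => ?_) ?_ ?_ (.of_forall fun y hy s hs => ?_) (by simp)
    (.of_forall fun y _ s _ => ?_)).2
  · exact (hf.continuous.comp (by fun_prop : Continuous fun y => (s, y))).aestronglyMeasurable
  · exact (hf.continuous.comp (by fun_prop : Continuous fun y => (t, y))).intervalIntegrable _ _
  · exact (hft.comp (by fun_prop : Continuous fun y => (t, y))).aestronglyMeasurable
  · exact hC (s, y) ⟨hs, uIoc_subset_uIcc hy⟩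
  · exact (hasDerivAt_fst_of_contDiff hf s y).differentiableAt.hasDerivAt

end PartialDerivatives

/-- With `ν = a³`, `|k| = κ³`, `c = 1/κ`, the dissipation of the energy density dominates the
cross terms at every point. -/
theorem hypocoercive_pointwise {a c κ k u p q py qy pyy qyy : ℝ} (ha : 0 < a) (hκ : 0 < κ)
    (hc : c * κ = 1) (hk : |k| = κ ^ 3) (hu : |u - 1| ≤ 1 / 2) :
    -(32 * a ^ 3 * (py ^ 2 + qy ^ 2))
      + a ^ 2 * c ^ 2 * (-(2 * a ^ 3 * (pyy ^ 2 + qyy ^ 2)) - 2 * k * u * (p * qy - q * py))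
      + a * c ^ 4 * (2 * a ^ 3 * k * (pyy * qy - qyy * py) - k ^ 2 * u * (p ^ 2 + q ^ 2))
      + (1 / 4 * a * κ ^ 2 * (p ^ 2 + q ^ 2) + a ^ 3 * (py ^ 2 + qy ^ 2)
        + a ^ 5 * c ^ 2 * (pyy ^ 2 + qyy ^ 2)) ≤ 0 := by
  have hc0 : 0 < c := by
    by_contra h
    nlinarith
  obtain ⟨hu1, hu2⟩ := abs_le.1 hu
  have hk2 : k ^ 2 = κ ^ 6 := by rw [← sq_abs, hk]; ring
  have young : ∀ x₁ x₂ y₁ y₂ : ℝ, |x₁ * y₂ - x₂ * y₁| ≤ (x₁ ^ 2 + x₂ ^ 2 + y₁ ^ 2 + y₂ ^ 2) / 2 := by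
    intro x₁ x₂ y₁ y₂
    rw [abs_le]
    constructor
    · nlinarith [sq_nonneg (x₁ + y₂), sq_nonneg (x₂ - y₁)]
    · nlinarith [sq_nonneg (x₁ - y₂), sq_nonneg (x₂ + y₁)]
  -- the shear term
  have h1 : -(a ^ 2 * c ^ 2 * (2 * k * u * (p * qy - q * py)))
      ≤ a * (κ ^ 2 / 4 * (p ^ 2 + q ^ 2) + 9 * a ^ 2 * (py ^ 2 + qy ^ 2)) := by
    have h := young (κ / 2 * p) (κ / 2 * q) (3 * a * py) (3 * a * qy)
    have e : κ / 2 * p * (3 * a * qy) - κ / 2 * q * (3 * a * py)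
        = κ * (3 / 2 * a) * (p * qy - q * py) := by ring
    rw [e, abs_mul, abs_of_pos (by positivity : 0 < κ * (3 / 2 * a))] at h
    have hu3 : |u| ≤ 3 / 2 := abs_le.2 ⟨by linarith, by linarith⟩
    calc -(a ^ 2 * c ^ 2 * (2 * k * u * (p * qy - q * py)))
        ≤ |a ^ 2 * c ^ 2 * (2 * k * u * (p * qy - q * py))| := neg_le_abs _
      _ = 2 * a ^ 2 * κ * (c * κ) ^ 2 * |u| * |p * qy - q * py| := by
          simp only [abs_mul, abs_pow, hk, abs_of_pos ha, abs_of_pos hc0, abs_two]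
          ring
      _ ≤ 2 * a ^ 2 * κ * (c * κ) ^ 2 * (3 / 2) * |p * qy - q * py| := by gcongr
      _ = 2 * a * (κ * (3 / 2 * a) * |p * qy - q * py|) := by rw [hc]; ring
      _ ≤ 2 * a * (((κ / 2 * p) ^ 2 + (κ / 2 * q) ^ 2 + (3 * a * py) ^ 2 + (3 * a * qy) ^ 2) / 2) := by
          gcongr
      _ = _ := by ring
  -- the viscous commutator
  have h2 : a * c ^ 4 * (2 * a ^ 3 * k * (pyy * qy - qyy * py))
      ≤ a ^ 3 * (py ^ 2 + qy ^ 2) + a ^ 5 * c ^ 2 * (pyy ^ 2 + qyy ^ 2) := by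
    have h := young (a * c * pyy) (a * c * qyy) py qy
    have e : a * c * pyy * qy - a * c * qyy * py = a * c * (pyy * qy - qyy * py) := by ring
    rw [e, abs_mul, abs_of_pos (by positivity : 0 < a * c)] at h
    calc a * c ^ 4 * (2 * a ^ 3 * k * (pyy * qy - qyy * py))
        ≤ |a * c ^ 4 * (2 * a ^ 3 * k * (pyy * qy - qyy * py))| := le_abs_self _
      _ = 2 * a ^ 3 * (c * κ) ^ 3 * (a * c * |pyy * qy - qyy * py|) := by
          simp only [abs_mul, abs_pow, hk, abs_of_pos ha, abs_of_pos hc0, abs_two]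
          ring
      _ = 2 * a ^ 3 * (a * c * |pyy * qy - qyy * py|) := by rw [hc]; ring
      _ ≤ 2 * a ^ 3 * (((a * c * pyy) ^ 2 + (a * c * qyy) ^ 2 + py ^ 2 + qy ^ 2) / 2) := by gcongr
      _ = _ := by ring
  -- the enhanced dissipation
  have h3 : a * κ ^ 2 / 2 * (p ^ 2 + q ^ 2) ≤ a * c ^ 4 * (k ^ 2 * u * (p ^ 2 + q ^ 2)) := by
    have e : a * c ^ 4 * (k ^ 2 * u * (p ^ 2 + q ^ 2))
        = a * κ ^ 2 * (c * κ) ^ 4 * (u * (p ^ 2 + q ^ 2)) := by rw [hk2]; ring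
    rw [e, hc]
    have : 0 ≤ a * κ ^ 2 * (p ^ 2 + q ^ 2) := by positivity
    nlinarith
  have h4 : 0 ≤ a ^ 3 * (py ^ 2 + qy ^ 2) := by positivity
  nlinarith [h1, h2, h3, h4]

theorem contDiff_energyDensity {p q : ℝ → ℝ → ℝ} (hp : ContDiff ℝ (⊤ : ℕ∞) (Function.uncurry p))
    (hq : ContDiff ℝ (⊤ : ℕ∞) (Function.uncurry q)) (β γ k : ℝ) :
    ContDiff ℝ (⊤ : ℕ∞) (Function.uncurry fun s y => 16 * (p s y ^ 2 + q s y ^ 2)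
      + β * (deriv (p s) y ^ 2 + deriv (q s) y ^ 2)
      + γ * (k * (p s y * deriv (q s) y - q s y * deriv (p s) y))) :=
  have hpy := contDiff_uncurry_deriv_snd hp
  have hqy := contDiff_uncurry_deriv_snd hq
  ((contDiff_const.mul ((hp.pow 2).add (hq.pow 2))).add
    (contDiff_const.mul ((hpy.pow 2).add (hqy.pow 2)))).add
    (contDiff_const.mul (contDiff_const.mul ((hp.mul hqy).sub (hq.mul hpy))))

/-- Local energy balance for `∂ₜθ + ikUθ = ν∂ᵧ²θ` with `θ = p + iq`, integrated over `[-1, 1]`. -/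
theorem hypocoercive_integral {a c κ k t : ℝ} {U p q : ℝ → ℝ → ℝ} (ha : 0 < a) (hκ : 0 < κ)
    (hc : c * κ = 1) (hk : |k| = κ ^ 3)
    (hU : ContDiff ℝ (⊤ : ℕ∞) (Function.uncurry U))
    (hp : ContDiff ℝ (⊤ : ℕ∞) (Function.uncurry p))
    (hq : ContDiff ℝ (⊤ : ℕ∞) (Function.uncurry q))
    (hU' : ∀ y ∈ Icc (-1 : ℝ) 1, |deriv (U t) y - 1| ≤ 1 / 2)
    (hpb : ∀ y ∈ ({-1, 1} : Set ℝ), p t y = 0) (hqb : ∀ y ∈ ({-1, 1} : Set ℝ), q t y = 0)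
    (hptb : ∀ y ∈ ({-1, 1} : Set ℝ), deriv (fun s => p s y) t = 0)
    (hqtb : ∀ y ∈ ({-1, 1} : Set ℝ), deriv (fun s => q s y) t = 0)
    (hpde₁ : ∀ y ∈ Icc (-1 : ℝ) 1,
      deriv (fun s => p s y) t - k * U t y * q t y = a ^ 3 * deriv (deriv (p t)) y)
    (hpde₂ : ∀ y ∈ Icc (-1 : ℝ) 1,
      deriv (fun s => q s y) t + k * U t y * p t y = a ^ 3 * deriv (deriv (q t)) y) :
    (∫ y in (-1 : ℝ)..1, (deriv (fun s => 16 * (p s y ^ 2 + q s y ^ 2)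
          + a ^ 2 * c ^ 2 * (deriv (p s) y ^ 2 + deriv (q s) y ^ 2)
          + a * c ^ 4 * (k * (p s y * deriv (q s) y - q s y * deriv (p s) y))) t
        + (1 / 4 * a * κ ^ 2 * (p t y ^ 2 + q t y ^ 2)
          + a ^ 3 * (deriv (p t) y ^ 2 + deriv (q t) y ^ 2)
          + a ^ 5 * c ^ 2 * (deriv (deriv (p t)) y ^ 2 + deriv (deriv (q t)) y ^ 2)))) ≤ 0 := by
  have slice : ∀ {g : ℝ → ℝ → ℝ}, ContDiff ℝ (⊤ : ℕ∞) (Function.uncurry g) →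
      Continuous fun y => g t y := fun hg =>
    hg.continuous.comp (by fun_prop : Continuous fun y : ℝ => (t, y))
  have dfst : ∀ {g : ℝ → ℝ → ℝ}, ContDiff ℝ (⊤ : ℕ∞) (Function.uncurry g) →
      ∀ y, HasDerivAt (fun s => g s y) (deriv (fun s => g s y) t) t := fun hg y =>
    (hasDerivAt_fst_of_contDiff hg t y).differentiableAt.hasDerivAt
  have dsnd : ∀ {g : ℝ → ℝ → ℝ}, ContDiff ℝ (⊤ : ℕ∞) (Function.uncurry g) →
      ∀ y, HasDerivAt (g t) (deriv (g t) y) y := fun hg y =>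
    (hasDerivAt_snd_of_contDiff hg t y).differentiableAt.hasDerivAt
  have hpy := contDiff_uncurry_deriv_snd hp
  have hqy := contDiff_uncurry_deriv_snd hq
  have hpt := contDiff_uncurry_deriv_fst hp
  have hqt := contDiff_uncurry_deriv_fst hq
  have he := contDiff_energyDensity hp hq (a ^ 2 * c ^ 2) (a * c ^ 4) k
  have het := slice (contDiff_uncurry_deriv_fst he)
  have cp := slice hp
  have cq := slice hq
  have cU := slice hU
  have cUy := slice (contDiff_uncurry_deriv_snd hU)
  have cpy := slice hpy
  have cqy := slice hqy
  have cpt := slice hpt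
  have cqt := slice hqt
  have cpyy := slice (contDiff_uncurry_deriv_snd hpy)
  have cqyy := slice (contDiff_uncurry_deriv_snd hqy)
  have cpty := slice (contDiff_uncurry_deriv_snd hpt)
  have cqty := slice (contDiff_uncurry_deriv_snd hqt)
  let flux : ℝ → ℝ := fun y =>
    32 * a ^ 3 * (deriv (p t) y * p t y + deriv (q t) y * q t y)
      + a ^ 2 * c ^ 2 * (2 * ((deriv (fun s => p s y) t - k * (U t y * q t y)) * deriv (p t) y
        + (deriv (fun s => q s y) t + k * (U t y * p t y)) * deriv (q t) y))
      + a * c ^ 4 * (k * (p t y * deriv (fun s => q s y) t - q t y * deriv (fun s => p s y) t)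
        + k ^ 2 * (U t y * (p t y ^ 2 + q t y ^ 2)))
  have hflux := fun y => (((((dsnd hpy y).mul (dsnd hp y)).add
      ((dsnd hqy y).mul (dsnd hq y))).const_mul (32 * a ^ 3)).add
    ((((((dsnd hpt y).sub (((dsnd hU y).mul (dsnd hq y)).const_mul k)).mul (dsnd hpy y)).add
      (((dsnd hqt y).add (((dsnd hU y).mul (dsnd hp y)).const_mul k)).mul
        (dsnd hqy y))).const_mul 2).const_mul (a ^ 2 * c ^ 2))).add
    ((((((dsnd hp y).mul (dsnd hqt y)).sub ((dsnd hq y).mul (dsnd hpt y))).const_mul k).add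
      (((dsnd hU y).mul (((dsnd hp y).pow 2).add ((dsnd hq y).pow 2))).const_mul
        (k ^ 2))).const_mul (a * c ^ 4))
  have hzero := intervalIntegral.integral_eq_sub_of_hasDerivAt (a := -1) (b := 1) (f := flux)
    (fun y _ => hflux y) (Continuous.intervalIntegrable (by fun_prop) _ _)
  have hb : flux 1 - flux (-1) = 0 := by
    simp only [flux]
    rw [hpb 1 (by simp), hpb (-1) (by simp), hqb 1 (by simp), hqb (-1) (by simp),
      hptb 1 (by simp), hptb (-1) (by simp), hqtb 1 (by simp), hqtb (-1) (by simp)]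
    ring
  rw [← hb, ← hzero]
  refine intervalIntegral.integral_mono_on (by norm_num)
    (Continuous.intervalIntegrable (by fun_prop) _ _)
    (Continuous.intervalIntegrable (by fun_prop) _ _) fun y hy => ?_
  have hder := (((((dfst hp y).pow 2).add ((dfst hq y).pow 2)).const_mul 16).add
    ((((dfst hpy y).pow 2).add ((dfst hqy y).pow 2)).const_mul (a ^ 2 * c ^ 2))).add
    (((((dfst hp y).mul (dfst hqy y)).sub ((dfst hq y).mul (dfst hpy y))).const_mul k).const_mul
      (a * c ^ 4))
  have hder' := hder.deriv
  simp only [Pi.add_def, Pi.mul_def, Pi.sub_def, Pi.pow_def] at hder'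
  rw [hder', deriv_deriv_comm_of_contDiff hp, deriv_deriv_comm_of_contDiff hq]
  have key := hypocoercive_pointwise (p := p t y) (q := q t y) (py := deriv (p t) y)
    (qy := deriv (q t) y) (pyy := deriv (deriv (p t)) y) (qyy := deriv (deriv (q t)) y)
    ha hκ hc hk (hU' y hy)
  have e₁ := hpde₁ y hy
  have e₂ := hpde₂ y hy
  rw [sub_eq_iff_eq_add] at e₁
  rw [← eq_sub_iff_add_eq] at e₂
  simp only [Pi.add_apply, Pi.mul_apply, Pi.sub_apply, Pi.pow_apply, e₁, e₂]
  refine sub_nonpos.1 (le_of_eq_of_le ?_ key)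
  push_cast
  ring

theorem hasDerivAt_complex_re {g : ℝ → ℂ} {g' : ℂ} {x : ℝ} (hg : HasDerivAt g g' x) :
    HasDerivAt (fun x => (g x).re) g'.re x :=
  Complex.reCLM.hasFDerivAt.comp_hasDerivAt x hg

theorem hasDerivAt_complex_im {g : ℝ → ℂ} {g' : ℂ} {x : ℝ} (hg : HasDerivAt g g' x) :
    HasDerivAt (fun x => (g x).im) g'.im x :=
  Complex.imCLM.hasFDerivAt.comp_hasDerivAt x hg

theorem deriv_eq_zero_of_eq_zero_on_Ici {g : ℝ → ℝ} {t : ℝ} (hg : DifferentiableAt ℝ g t)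
    (ht : 0 ≤ t) (h : ∀ s ≥ (0 : ℝ), g s = 0) : deriv g t = 0 := by
  have h₁ := hg.hasDerivAt.hasDerivWithinAt (s := Ici 0)
  have h₂ : HasDerivWithinAt g 0 (Ici 0) t :=
    (hasDerivWithinAt_const t (Ici 0) (0 : ℝ)).congr h (h t ht)
  exact (uniqueDiffOn_Ici 0 t ht).eq_deriv _ h₁ h₂

theorem stmt_11 (ν δ₀ : ℝ) (hν : ν ∈ Ioc (0:ℝ) 1) (hδ : δ₀ ∈ Ioo (0:ℝ) (1/2))
    (k : ℤ) (hk : k ≠ 0)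
    (U : ℝ → ℝ → ℝ) (hU : ContDiff ℝ (⊤ : ℕ∞) (Function.uncurry U))
    (hU' : ∀ t ≥ (0:ℝ), ∀ y ∈ Icc (-1:ℝ) 1, |deriv (U t) y - 1| ≤ δ₀)
    (θ : ℝ → ℝ → ℂ) (hθ : ContDiff ℝ (⊤ : ℕ∞) (Function.uncurry θ))
    (hbd : ∀ t ≥ (0:ℝ), θ t (-1) = 0 ∧ θ t 1 = 0)
    (hpde : ∀ t ≥ (0:ℝ), ∀ y ∈ Icc (-1:ℝ) 1,
      deriv (fun s => θ s y) t + Complex.I * (k : ℂ) * (U t y : ℂ) * θ t y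
        - (ν : ℂ) * deriv (deriv (θ t)) y = 0)
    (E : ℝ → ℝ)
    (hE : ∀ t, E t = 16 * (∫ y in (-1:ℝ)..1, ‖θ t y‖^2)
      + ν ^ ((2:ℝ)/3) * |(k : ℝ)| ^ (-(2:ℝ)/3) * (∫ y in (-1:ℝ)..1, ‖deriv (θ t) y‖^2)
      + ν ^ ((1:ℝ)/3) * |(k : ℝ)| ^ (-(4:ℝ)/3) *
          (∫ y in (-1:ℝ)..1,
            Complex.I * (k : ℂ) * θ t y * (starRingEnd ℂ) (deriv (θ t) y)).re) :
    ∀ t ≥ (0:ℝ), ∃ d : ℝ, HasDerivWithinAt E d (Ici 0) t ∧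
      d + (1/4) * ν ^ ((1:ℝ)/3) * |(k : ℝ)| ^ ((2:ℝ)/3) * (∫ y in (-1:ℝ)..1, ‖θ t y‖^2)
        + ν * (∫ y in (-1:ℝ)..1, ‖deriv (θ t) y‖^2)
        + ν ^ ((5:ℝ)/3) * |(k : ℝ)| ^ (-(2:ℝ)/3) *
            (∫ y in (-1:ℝ)..1, ‖deriv (deriv (θ t)) y‖^2) ≤ 0 := by
  have hν0 := hν.1
  have hk0 : 0 < |(k : ℝ)| := abs_pos.2 (by exact_mod_cast hk)
  obtain ⟨a, ha_def⟩ : ∃ a, a = ν ^ ((1 : ℝ) / 3) := ⟨_, rfl⟩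
  obtain ⟨κ, hκ_def⟩ : ∃ κ, κ = |(k : ℝ)| ^ ((1 : ℝ) / 3) := ⟨_, rfl⟩
  obtain ⟨c, hc_def⟩ : ∃ c, c = κ⁻¹ := ⟨_, rfl⟩
  have ha : 0 < a := ha_def ▸ Real.rpow_pos_of_pos hν0 _
  have hκ : 0 < κ := hκ_def ▸ Real.rpow_pos_of_pos hk0 _
  have hc : c * κ = 1 := hc_def ▸ inv_mul_cancel₀ hκ.ne'
  have hcκ : c = |(k : ℝ)| ^ (-(1 : ℝ) / 3) := by
    rw [hc_def, hκ_def, ← Real.rpow_neg hk0.le, neg_div]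
  have root_pow : ∀ {x : ℝ} (r : ℝ) (n : ℕ), 0 < x → (x ^ r) ^ n = x ^ (r * n) := fun r n hx => by
    rw [← Real.rpow_natCast, ← Real.rpow_mul hx.le]
  have hν3 : ν = a ^ 3 := by rw [ha_def, root_pow _ _ hν0]; norm_num
  have hν2 : ν ^ ((2 : ℝ) / 3) = a ^ 2 := by rw [ha_def, root_pow _ _ hν0]; norm_num
  have hν5 : ν ^ ((5 : ℝ) / 3) = a ^ 5 := by rw [ha_def, root_pow _ _ hν0]; norm_num
  have hk3 : |(k : ℝ)| = κ ^ 3 := by rw [hκ_def, root_pow _ _ hk0]; norm_num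
  have hk2 : |(k : ℝ)| ^ ((2 : ℝ) / 3) = κ ^ 2 := by rw [hκ_def, root_pow _ _ hk0]; norm_num
  have hkn2 : |(k : ℝ)| ^ (-(2 : ℝ) / 3) = c ^ 2 := by rw [hcκ, root_pow _ _ hk0]; norm_num
  have hkn4 : |(k : ℝ)| ^ (-(4 : ℝ) / 3) = c ^ 4 := by rw [hcκ, root_pow _ _ hk0]; norm_num
  rw [hν2, ← ha_def, hkn2, hkn4] at hE
  rw [hν5, ← ha_def, hkn2, hk2]
  let p : ℝ → ℝ → ℝ := fun t y => (θ t y).re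
  let q : ℝ → ℝ → ℝ := fun t y => (θ t y).im
  have hp : ContDiff ℝ (⊤ : ℕ∞) (Function.uncurry p) := Complex.reCLM.contDiff.comp hθ
  have hq : ContDiff ℝ (⊤ : ℕ∞) (Function.uncurry q) := Complex.imCLM.contDiff.comp hθ
  have hθy := contDiff_uncurry_deriv_snd hθ
  have dsnd : ∀ {g : ℝ → ℝ → ℂ}, ContDiff ℝ (⊤ : ℕ∞) (Function.uncurry g) →
      ∀ t y, HasDerivAt (g t) (deriv (g t) y) y := fun hg t y =>
    (hasDerivAt_snd_of_contDiff hg t y).differentiableAt.hasDerivAt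
  have hpy_eq : ∀ t, deriv (p t) = fun y => (deriv (θ t) y).re := fun t =>
    funext fun y => (hasDerivAt_complex_re (dsnd hθ t y)).deriv
  have hqy_eq : ∀ t, deriv (q t) = fun y => (deriv (θ t) y).im := fun t =>
    funext fun y => (hasDerivAt_complex_im (dsnd hθ t y)).deriv
  have hpyy_eq : ∀ t y, deriv (deriv (p t)) y = (deriv (deriv (θ t)) y).re := fun t y => by
    rw [hpy_eq]; exact (hasDerivAt_complex_re (dsnd hθy t y)).deriv
  have hqyy_eq : ∀ t y, deriv (deriv (q t)) y = (deriv (deriv (θ t)) y).im := fun t y => by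
    rw [hqy_eq]; exact (hasDerivAt_complex_im (dsnd hθy t y)).deriv
  have hpt_eq : ∀ t y, deriv (fun s => p s y) t = (deriv (fun s => θ s y) t).re := fun t y =>
    (hasDerivAt_complex_re
      (hasDerivAt_fst_of_contDiff hθ t y).differentiableAt.hasDerivAt).deriv
  have hqt_eq : ∀ t y, deriv (fun s => q s y) t = (deriv (fun s => θ s y) t).im := fun t y =>
    (hasDerivAt_complex_im
      (hasDerivAt_fst_of_contDiff hθ t y).differentiableAt.hasDerivAt).deriv
  have nsq : ∀ z : ℂ, ‖z‖ ^ 2 = z.re ^ 2 + z.im ^ 2 := fun z => by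
    rw [← Complex.normSq_eq_norm_sq, Complex.normSq_apply]; ring
  have slice : ∀ {G : Type} [NormedAddCommGroup G] [NormedSpace ℝ G] {g : ℝ → ℝ → G},
      ContDiff ℝ (⊤ : ℕ∞) (Function.uncurry g) → ∀ t, Continuous fun y => g t y := fun hg t =>
    hg.continuous.comp (by fun_prop : Continuous fun y : ℝ => (t, y))
  have hE' : E = fun s => ∫ y in (-1 : ℝ)..1, (16 * (p s y ^ 2 + q s y ^ 2)
          + a ^ 2 * c ^ 2 * (deriv (p s) y ^ 2 + deriv (q s) y ^ 2)
          + a * c ^ 4 * ((k : ℝ) * (p s y * deriv (q s) y - q s y * deriv (p s) y))) := by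
    funext s
    have c₀ := slice hθ s
    have c₁ := slice hθy s
    have hre : (∫ y in (-1 : ℝ)..1,
        Complex.I * (k : ℂ) * θ s y * (starRingEnd ℂ) (deriv (θ s) y)).re
        = ∫ y in (-1 : ℝ)..1,
          (Complex.I * (k : ℂ) * θ s y * (starRingEnd ℂ) (deriv (θ s) y)).re :=
      (Complex.reCLM.intervalIntegral_comp_comm
        (Continuous.intervalIntegrable (by fun_prop) _ _)).symm
    rw [hE, hre, ← intervalIntegral.integral_const_mul, ← intervalIntegral.integral_const_mul,
      ← intervalIntegral.integral_const_mul, ← intervalIntegral.integral_add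
        (Continuous.intervalIntegrable (by fun_prop) _ _)
        (Continuous.intervalIntegrable (by fun_prop) _ _), ← intervalIntegral.integral_add
        (Continuous.intervalIntegrable (by fun_prop) _ _)
        (Continuous.intervalIntegrable (by fun_prop) _ _)]
    refine intervalIntegral.integral_congr fun y _ => ?_
    simp only [nsq, hpy_eq, hqy_eq, p, q, Complex.mul_re, Complex.mul_im, Complex.I_re,
      Complex.I_im, Complex.intCast_re, Complex.intCast_im, Complex.conj_re, Complex.conj_im]
    ring
  have he := contDiff_energyDensity hp hq (a ^ 2 * c ^ 2) (a * c ^ 4) k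
  intro t ht
  have bdry : ∀ y ∈ ({-1, 1} : Set ℝ), ∀ s ≥ (0 : ℝ), θ s y = 0 := by
    rintro y (rfl | rfl) s hs
    exacts [(hbd s hs).1, (hbd s hs).2]
  have key := hypocoercive_integral (t := t) (U := U) ha hκ hc hk3 hU hp hq
    (fun y hy => (hU' t ht y hy).trans hδ.2.le)
    (fun y hy => by simp [p, bdry y hy t ht]) (fun y hy => by simp [q, bdry y hy t ht])
    (fun y hy => deriv_eq_zero_of_eq_zero_on_Ici
      (hasDerivAt_fst_of_contDiff hp t y).differentiableAt ht
      fun s hs => by simp [p, bdry y hy s hs])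
    (fun y hy => deriv_eq_zero_of_eq_zero_on_Ici
      (hasDerivAt_fst_of_contDiff hq t y).differentiableAt ht
      fun s hs => by simp [q, bdry y hy s hs])
    (fun y hy => by
      have h := congrArg Complex.re (hpde t ht y hy)
      simp at h
      rw [hpt_eq, hpyy_eq, ← hν3]
      simp only [q]
      linarith)
    (fun y hy => by
      have h := congrArg Complex.im (hpde t ht y hy)
      simp at h
      rw [hqt_eq, hqyy_eq, ← hν3]
      simp only [p]
      linarith)
  refine ⟨_, hE' ▸ (hasDerivAt_intervalIntegral_of_contDiff he (-1) 1 t).hasDerivWithinAt, ?_⟩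
  have c₀ := slice hθ t
  have c₁ := slice hθy t
  have c₂ := slice (contDiff_uncurry_deriv_snd hθy) t
  refine le_of_eq_of_le ?_ key
  rw [intervalIntegral.integral_add
      ((slice (contDiff_uncurry_deriv_fst he) t).intervalIntegrable _ _)
      (Continuous.intervalIntegrable ?_ _ _)]
  · simp only [add_assoc]
    congr 1
    rw [← intervalIntegral.integral_const_mul, ← intervalIntegral.integral_const_mul,
      ← intervalIntegral.integral_const_mul, ← intervalIntegral.integral_add
        (Continuous.intervalIntegrable (by fun_prop) _ _)
        (Continuous.intervalIntegrable (by fun_prop) _ _), ← intervalIntegral.integral_add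
        (Continuous.intervalIntegrable (by fun_prop) _ _)
        (Continuous.intervalIntegrable (by fun_prop) _ _)]
    refine intervalIntegral.integral_congr fun y _ => ?_
    simp only [nsq, hpyy_eq, hqyy_eq, p, q]
    simp only [hpy_eq, hqy_eq, p, q, ← hν3]
  · simp only [hpyy_eq, hqyy_eq]
    simp only [hpy_eq, hqy_eq, p, q]
    fun_prop
end
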